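/- arXiv:1904.06035 — 2 statements merged into one kernel-verified Lean document; each statement's English description precedes it below -/
import Mathlib

section
/- Let k be a field and R an associative unital k-algebra. The operator 𝒞 is a Kuratowski closure operator on the collection of finitely generated left R-modules (up to isomorphism); that is, for all sets 𝒳, 𝒴 of finitely generated left R-modules: (1) 𝒞(∅) = ∅; (2) 𝒳 ⊆ 𝒞(𝒳); (3) 𝒞(𝒳 ∪ 𝒴) = 𝒞(𝒳) ∪ 𝒞(𝒴); (4) 𝒞(𝒞(𝒳)) = 𝒞(𝒳). -/
open Polynomial TensorProduct

noncomputable section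

/-- The prime ideal `(t)` of the polynomial ring `k[t]`. -/
def tIdeal (k : Type) [Field k] : Ideal (Polynomial k) := Ideal.span {Polynomial.X}

instance tIdeal_isPrime (k : Type) [Field k] : (tIdeal k).IsPrime := by
  have h : tIdeal k = RingHom.ker (Polynomial.evalRingHom (0 : k)) := by
    rw [Polynomial.ker_evalRingHom]
    simp [tIdeal]
  rw [h]
  exact RingHom.ker_isPrime _

/-- `V = k[t]_{(t)}`, the localization of the polynomial ring `k[t]` at the prime ideal `(t)`. -/
def DegV (k : Type) [Field k] : Type := Localization.AtPrime (tIdeal k)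

instance (k : Type) [Field k] : CommRing (DegV k) :=
  inferInstanceAs (CommRing (Localization.AtPrime (tIdeal k)))

instance (k : Type) [Field k] : Algebra (Polynomial k) (DegV k) :=
  inferInstanceAs (Algebra (Polynomial k) (Localization.AtPrime (tIdeal k)))

instance (k : Type) [Field k] : Algebra k (DegV k) :=
  inferInstanceAs (Algebra k (Localization.AtPrime (tIdeal k)))

instance (k : Type) [Field k] : IsScalarTower k (Polynomial k) (DegV k) :=
  inferInstanceAs (IsScalarTower k (Polynomial k) (Localization.AtPrime (tIdeal k)))

/-- The element `t` of `V = k[t]_{(t)}`. -/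
def degT (k : Type) [Field k] : DegV k := algebraMap (Polynomial k) (DegV k) Polynomial.X

/-- `K = V[t⁻¹]`, which is the fraction field `k(t)` of `V = k[t]_{(t)}`. -/
def DegK (k : Type) [Field k] : Type := Localization (Submonoid.powers (degT k))

instance (k : Type) [Field k] : CommRing (DegK k) :=
  inferInstanceAs (CommRing (Localization (Submonoid.powers (degT k))))

instance (k : Type) [Field k] : Algebra (DegV k) (DegK k) :=
  inferInstanceAs (Algebra (DegV k) (Localization (Submonoid.powers (degT k))))

instance (k : Type) [Field k] : Algebra k (DegK k) :=
  inferInstanceAs (Algebra k (Localization (Submonoid.powers (degT k))))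

/-- The localized module `Q[t⁻¹]` is a module over `K = V[t⁻¹]`. -/
instance (k : Type) [Field k] (Q : Type) [AddCommGroup Q] [Module (DegV k) Q] :
    Module (DegK k) (LocalizedModule (Submonoid.powers (degT k)) Q) :=
  inferInstanceAs (Module (Localization (Submonoid.powers (degT k)))
    (LocalizedModule (Submonoid.powers (degT k)) Q))

section

variable (k : Type) [Field k] (R : Type) [Ring R] [Algebra k R]

/-- `1 ⊗ t` is central in `R ⊗[k] V`. -/
theorem degT_central (x : R ⊗[k] DegV k) :
    x * ((1 : R) ⊗ₜ[k] degT k) = ((1 : R) ⊗ₜ[k] degT k) * x := by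
  induction x with
  | zero => simp
  | tmul a v => simp [Algebra.TensorProduct.tmul_mul_tmul, mul_comm]
  | add x y hx hy => simp [add_mul, mul_add, hx, hy]

/-- Multiplication by `1 ⊗ t` on an `R ⊗[k] V`-module, as an `R ⊗[k] V`-linear map. -/
def tSmul (Q : Type) [AddCommGroup Q] [Module (R ⊗[k] DegV k) Q] :
    Q →ₗ[R ⊗[k] DegV k] Q where
  toFun q := ((1 : R) ⊗ₜ[k] degT k) • q
  map_add' := smul_add _
  map_smul' x q := by
    simp only [RingHom.id_apply, ← mul_smul, degT_central]

/-- The `R`-module structure on an `R ⊗[k] V`-module obtained by restriction of scalars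
along `R → R ⊗[k] V`. -/
def rRestrict (Q : Type) [AddCommGroup Q] [Module (R ⊗[k] DegV k) Q] : Module R Q :=
  Module.compHom Q (Algebra.TensorProduct.includeLeftRingHom : R →+* R ⊗[k] DegV k)

/-- The `V`-module structure on an `R ⊗[k] V`-module obtained by restriction of scalars
along `V → R ⊗[k] V`. -/
def vRestrict (Q : Type) [AddCommGroup Q] [Module (R ⊗[k] DegV k) Q] : Module (DegV k) Q :=
  Module.compHom Q
    ((Algebra.TensorProduct.includeRight : DegV k →ₐ[k] R ⊗[k] DegV k) : DegV k →+* R ⊗[k] DegV k)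

/-- The action of `r : R` on an `R ⊗[k] V`-module `Q`, as a `V`-linear endomorphism of `Q`. -/
def rAct (Q : Type) [AddCommGroup Q] [Module (R ⊗[k] DegV k) Q] (r : R) :
    letI := vRestrict k R Q
    Q →ₗ[DegV k] Q :=
  letI := vRestrict k R Q
  { toFun := fun q => (r ⊗ₜ[k] (1 : DegV k)) • q
    map_add' := smul_add _
    map_smul' := fun v q => by
      show (r ⊗ₜ[k] (1 : DegV k)) • (((1 : R) ⊗ₜ[k] v) • q)
        = ((1 : R) ⊗ₜ[k] v) • ((r ⊗ₜ[k] (1 : DegV k)) • q)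
      rw [← mul_smul, ← mul_smul, Algebra.TensorProduct.tmul_mul_tmul,
        Algebra.TensorProduct.tmul_mul_tmul, one_mul, mul_one, one_mul, mul_one] }

/-- The action of `r : R` on a module `M`, as a `k`-linear endomorphism of `M`
(where `M` is viewed as a `k`-module by restriction of scalars along `k → R`). -/
def rActK (M : Type) [AddCommGroup M] [Module R M] (r : R) :
    letI := Module.compHom M (algebraMap k R)
    M →ₗ[k] M :=
  letI := Module.compHom M (algebraMap k R)
  { toFun := fun m => r • m
    map_add' := smul_add r
    map_smul' := fun c m => by
      show r • ((algebraMap k R c) • m) = (algebraMap k R c) • (r • m)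
      rw [← mul_smul, ← mul_smul, Algebra.commutes] }

/-- Degeneration of modules (Yoshino): `M ⇒_deg N` iff there is a finitely generated
`R ⊗[k] V`-module `Q`, flat over `V`, with `Q/tQ ≅ N` as `R`-modules and
`Q_t = Q[t⁻¹] ≅ M ⊗[k] K` compatibly with the `R`- and `K`-actions
(i.e. as `R ⊗[k] K`-modules). -/
def Degenerates (M N : Type) [AddCommGroup M] [Module R M] [AddCommGroup N] [Module R N] :
    Prop :=
  ∃ (Q : Type) (_ : AddCommGroup Q) (_ : Module (R ⊗[k] DegV k) Q),
    Module.Finite (R ⊗[k] DegV k) Q ∧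
    (letI := vRestrict k R Q; Module.Flat (DegV k) Q) ∧
    -- `Q/tQ ≅ N` as `R`-modules
    (letI := rRestrict k R (Q ⧸ LinearMap.range (tSmul k R Q))
     Nonempty ((Q ⧸ LinearMap.range (tSmul k R Q)) ≃ₗ[R] N)) ∧
    -- `Q_t ≅ M ⊗_k K` as `R ⊗_k K`-modules, i.e. compatibly with both actions
    (letI := vRestrict k R Q
     letI : Module k M := Module.compHom M (algebraMap k R)
     ∃ f : LocalizedModule (Submonoid.powers (degT k)) Q ≃+ (M ⊗[k] DegK k),
       (∀ (c : DegK k) (x : LocalizedModule (Submonoid.powers (degT k)) Q),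
          f (c • x) = LinearMap.lTensor M (LinearMap.mulLeft k c) (f x)) ∧
       (∀ (r : R) (x : LocalizedModule (Submonoid.powers (degT k)) Q),
          f (LocalizedModule.map (Submonoid.powers (degT k)) (rAct k R Q r) x)
            = LinearMap.rTensor (DegK k) (rActK k R M r) (f x)))

end

/-- A bundled finitely generated (left) `R`-module. -/
structure FGMod (R : Type) [Ring R] where
  carrier : Type
  [addCommGroup : AddCommGroup carrier]
  [module : Module R carrier]
  [finite : Module.Finite R carrier]

attribute [instance] FGMod.addCommGroup FGMod.module FGMod.finite

/-- The operator `𝒞` on sets of finitely generated `R`-modules: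
`𝒞(𝒳)` consists of the f.g. modules `N` such that `M^{⊕n} ⇒_deg N^{⊕n}`
for some `M ∈ 𝒳` and some `n > 0`. -/
def CC (k : Type) [Field k] (R : Type) [Ring R] [Algebra k R] (X : Set (FGMod R)) :
    Set (FGMod R) :=
  {N | ∃ M ∈ X, ∃ n : ℕ, 0 < n ∧
    Degenerates k R (Fin n → M.carrier) (Fin n → N.carrier)}

/-- The shift (multiplication by `t`) on formal power series with coefficients in `M`. -/
def shiftS (R M : Type) [Ring R] [AddCommGroup M] [Module R M] : (ℕ → M) →ₗ[R] (ℕ → M) where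
  toFun f n := match n with
    | 0 => 0
    | n + 1 => f n
  map_add' f g := by
    funext n; cases n <;> simp
  map_smul' r f := by
    funext n; cases n <;> simp

section
variable {R M N P : Type} [Ring R] [AddCommGroup M] [Module R M] [AddCommGroup N] [Module R N]
  [AddCommGroup P] [Module R P]

@[simp] theorem shiftS_zero (f : ℕ → M) : shiftS R M f 0 = 0 := rfl
@[simp] theorem shiftS_succ (f : ℕ → M) (n : ℕ) : shiftS R M f (n + 1) = f n := rfl

theorem shiftS_inj {f g : ℕ → M} (h : shiftS R M f = shiftS R M g) : f = g := by
  funext n; exact congrFun h (n + 1)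

theorem shiftS_tail {f : ℕ → M} (h : f 0 = 0) : shiftS R M (fun n => f (n + 1)) = f := by
  funext n; cases n <;> simp [h]

variable (R M N) in
/-- Lattice criterion for degenerations. -/
def Crit : Prop :=
  ∃ (b : ℕ) (Q : Submodule R (ℕ → M)) (p : Q →ₗ[R] N),
    (∀ f ∈ Q, shiftS R M f ∈ Q) ∧
    (∀ f : ℕ → M, (∀ i < b, f i = 0) → f ∈ Q) ∧
    Function.Surjective p ∧
    (∀ x : Q, p x = 0 ↔ ∃ y ∈ Q, shiftS R M y = x)

theorem Crit.refl : Crit R M M := by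
  refine ⟨0, ⊤, (LinearMap.proj 0).comp (Submodule.subtype _), by simp, by simp, ?_, ?_⟩
  · intro m
    exact ⟨⟨fun _ => m, trivial⟩, rfl⟩
  · rintro ⟨f, -⟩
    constructor
    · intro h
      exact ⟨_, trivial, shiftS_tail h⟩
    · rintro ⟨y, -, rfl⟩
      rfl

theorem Crit.congr {M' N' : Type} [AddCommGroup M'] [Module R M'] [AddCommGroup N'] [Module R N']
    (h : Crit R M N) (e : M ≃ₗ[R] M') (e' : N ≃ₗ[R] N') : Crit R M' N' := by
  obtain ⟨b, Q, p, h1, h2, h3, h4⟩ := h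
  let E : (ℕ → M') →ₗ[R] (ℕ → M) := LinearMap.compLeft (e.symm : M' →ₗ[R] M) ℕ
  have hE : ∀ f n, E f n = e.symm (f n) := fun f n => rfl
  have hs : ∀ f, E (shiftS R M' f) = shiftS R M (E f) := by
    intro f; funext n; cases n <;> simp [hE]
  refine ⟨b, Q.comap E, (e' : N →ₗ[R] N').comp (p.comp (E.restrict (fun x hx => hx))), ?_, ?_, ?_, ?_⟩
  · intro f hf
    simp only [Submodule.mem_comap, hs] at *
    exact h1 _ hf
  · intro f hf
    apply h2
    intro i hi
    simp [hE, hf i hi]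
  · intro n
    obtain ⟨⟨x, hx⟩, hx'⟩ := h3 (e'.symm n)
    have : E (fun n => e (x n)) = x := by funext n; simp [hE]
    refine ⟨⟨fun n => e (x n), by rw [Submodule.mem_comap, this]; exact hx⟩, ?_⟩
    have h5 : (E.restrict (fun x hx => hx) : Q.comap E →ₗ[R] Q)
      ⟨fun n => e (x n), by rw [Submodule.mem_comap, this]; exact hx⟩ = ⟨x, hx⟩ := Subtype.ext this
    simp only [LinearMap.comp_apply]
    rw [h5, hx']; simp
  · rintro ⟨x, hx⟩
    have := h4 ⟨E x, hx⟩
    simp only [LinearMap.comp_apply, LinearEquiv.coe_coe, LinearEquiv.map_eq_zero_iff]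
    refine this.trans ?_
    constructor
    · rintro ⟨y, hy, hyx⟩
      have : E (fun n => e (y n)) = y := by funext n; simp [hE]
      refine ⟨fun n => e (y n), by rw [Submodule.mem_comap, this]; exact hy, ?_⟩
      funext n
      apply e.symm.injective
      have h6 := congrFun hyx n
      simp only [hE] at h6
      rw [← h6]
      cases n <;> simp
    · rintro ⟨y, hy, hyx⟩
      exact ⟨E y, hy, by rw [← hs, hyx]⟩

theorem Crit.pi (ι : Type) (h : Crit R M N) : Crit R (ι → M) (ι → N) := by
  obtain ⟨b, Q, p, h1, h2, h3, h4⟩ := h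
  let E : ι → (ℕ → ι → M) →ₗ[R] (ℕ → M) := fun i => LinearMap.compLeft (LinearMap.proj i) ℕ
  have hE : ∀ i f n, E i f n = f n i := fun i f n => rfl
  have hs : ∀ i f, E i (shiftS R _ f) = shiftS R M (E i f) := by
    intro i f; funext n; cases n <;> simp [hE]
  let Q' : Submodule R (ℕ → ι → M) := ⨅ i, Q.comap (E i)
  have hQ' : ∀ x, x ∈ Q' ↔ ∀ i, E i x ∈ Q := by intro x; simp [Q']
  refine ⟨b, Q', LinearMap.pi (fun i => p.comp ((E i).restrict (fun x hx => (hQ' x).1 hx i))),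
    ?_, ?_, ?_, ?_⟩
  · intro f hf
    rw [hQ'] at *
    intro i
    rw [hs]
    exact h1 _ (hf i)
  · intro f hf
    rw [hQ']
    intro i
    apply h2
    intro n hn
    simp [hE, hf n hn]
  · intro n
    choose x hx using fun i => h3 (n i)
    refine ⟨⟨fun n i => (x i).1 n, (hQ' _).2 fun i => (x i).2⟩, ?_⟩
    funext i
    rw [← hx i]
    rfl
  · rintro ⟨x, hx⟩
    have : (∀ i, p ⟨E i x, (hQ' x).1 hx i⟩ = 0) ↔ ∃ y ∈ Q', shiftS R (ι → M) y = x := by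
      simp only [h4]
      constructor
      · intro h
        choose y hy hyx using h
        refine ⟨fun n i => y i n, (hQ' _).2 hy, ?_⟩
        funext n i
        have := congrFun (hyx i) n
        rw [hE] at this
        rw [← this]
        cases n <;> rfl
      · rintro ⟨y, hy, rfl⟩ i
        exact ⟨_, (hQ' y).1 hy i, (hs i y).symm⟩
    rw [← this]
    exact funext_iff

theorem Crit.trans (h : Crit R M N) (h' : Crit R N P) : Crit R M P := by
  obtain ⟨b, Q, p, h1, h2, h3, h4⟩ := h
  obtain ⟨c, Q', p', h1', h2', h3', h4'⟩ := h'
  let d := c + 1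
  -- components
  let E : ℕ → (ℕ → M) →ₗ[R] (ℕ → M) := fun j => LinearMap.funLeft R M (fun i => d * i + j)
  have hE : ∀ j f i, E j f i = f (d * i + j) := fun i f n => rfl
  have hEs : ∀ j f, E (j + 1) (shiftS R M f) = E j f := by
    intro j f; funext n; rw [hE, hE, ← add_assoc, shiftS_succ]
  have hE0 : ∀ f, E 0 (shiftS R M f) = shiftS R M (E c f) := by
    intro f; funext n
    cases n with
    | zero => simp [hE]
    | succ n =>
      rw [hE, shiftS_succ, hE, show d * (n + 1) + 0 = (d * n + c) + 1 by simp only [d]; ring,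
        shiftS_succ]
  let Q1 : Submodule R (ℕ → M) := ⨅ j : Fin d, Q.comap (E j)
  have hQ1 : ∀ x, x ∈ Q1 ↔ ∀ j < d, E j x ∈ Q := by
    intro x; simp [Q1, Fin.forall_iff]
  let φ : Q1 →ₗ[R] (ℕ → N) := LinearMap.pi fun j =>
    if hj : j < d then p.comp ((E j).restrict (fun x hx => (hQ1 x).1 hx j hj)) else 0
  have hφ : ∀ (x : Q1) j (hj : j < d), φ x j = p ⟨E j x, (hQ1 x).1 x.2 j hj⟩ := by
    intro x j hj
    simp only [φ, LinearMap.pi_apply, dif_pos hj]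
    rfl
  have hφ' : ∀ (x : Q1) j (hj : ¬ j < d), φ x j = 0 := by
    intro x j hj
    simp only [φ, LinearMap.pi_apply, dif_neg hj]
    rfl
  -- `Q'` facts
  have hcongr : ∀ f g : ℕ → N, (∀ i < c, f i = g i) → f ∈ Q' → g ∈ Q' := by
    intro f g hfg hf
    have : g - f ∈ Q' := h2' _ (by intro i hi; simp [hfg i hi])
    simpa using Q'.add_mem this hf
  have hcongr' : ∀ f g : Q', (∀ i < d, f.1 i = g.1 i) → p' f = p' g := by
    intro f g hfg
    rw [← sub_eq_zero, ← map_sub, h4']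
    refine ⟨fun n => (f - g).1 (n + 1), h2' _ ?_, shiftS_tail ?_⟩
    · intro i hi
      simp [hfg (i + 1) (by omega)]
    · simp [hfg 0 (by omega)]
  have hshQ1 : ∀ f ∈ Q1, shiftS R M f ∈ Q1 := by
    intro f hf
    rw [hQ1] at *
    intro j hj
    cases j with
    | zero => rw [hE0]; exact h1 _ (hf c (by omega))
    | succ j => rw [hEs]; exact hf j (by omega)
  have hφs : ∀ (f : Q1) i, i < d → φ ⟨_, hshQ1 f f.2⟩ i = shiftS R N (φ f) i := by
    intro f i hi
    rw [hφ _ _ hi]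
    cases i with
    | zero =>
      rw [shiftS_zero, h4]
      exact ⟨E c f, (hQ1 _).1 f.2 c (by omega), (hE0 _).symm⟩
    | succ i =>
      rw [shiftS_succ, hφ _ _ (by omega)]
      congr 2
  have hbuild : ∀ g : ℕ → ℕ → M, ∃ f : ℕ → M, ∀ j < d, E j f = g j := by
    intro g
    refine ⟨fun n => g (n % d) (n / d), fun j hj => ?_⟩
    funext i
    rw [hE, Nat.mul_add_mod, Nat.mod_eq_of_lt hj, Nat.mul_add_div (by omega),
      Nat.div_eq_of_lt hj, add_zero]
  let EE : Submodule R (ℕ → M) := (Q'.comap φ).map Q1.subtype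
  have hEE : ∀ x, x ∈ EE ↔ ∃ h : x ∈ Q1, φ ⟨x, h⟩ ∈ Q' := by
    intro x; simp [EE]
  let π : EE →ₗ[R] P := p'.comp (LinearMap.codRestrict Q'
    (φ.comp (Submodule.inclusion (fun x hx => ((hEE x).1 hx).1)))
    (fun x => ((hEE x).1 x.2).2))
  have hπ : ∀ x (hx : x ∈ EE), π ⟨x, hx⟩ = p' ⟨φ ⟨x, ((hEE x).1 hx).1⟩, ((hEE x).1 hx).2⟩ :=
    fun x hx => rfl
  refine ⟨d * (b + 1), EE, π, ?_, ?_, ?_, ?_⟩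
  · intro f hf
    rw [hEE] at hf ⊢
    obtain ⟨hf, hf'⟩ := hf
    refine ⟨hshQ1 f hf, hcongr _ _ (fun i hi => (hφs ⟨f, hf⟩ i (by omega)).symm) (h1' _ hf')⟩
  · intro f hf
    have hz : ∀ j < d, ∀ i < b + 1, E j f i = 0 := by
      intro j hj i hi
      rw [hE]
      apply hf
      calc d * i + j < d * i + d := by omega
        _ = d * (i + 1) := by ring
        _ ≤ d * (b + 1) := Nat.mul_le_mul_left _ hi
    have hfQ : f ∈ Q1 := (hQ1 f).2 fun j hj => h2 _ fun i hi => hz j hj i (by omega)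
    rw [hEE]
    refine ⟨hfQ, ?_⟩
    have : φ ⟨f, hfQ⟩ = 0 := by
      funext j
      by_cases hj : j < d
      · rw [hφ _ _ hj, Pi.zero_apply, h4]
        exact ⟨fun n => E j f (n + 1), h2 _ (fun i hi => hz j hj _ (by omega)),
          shiftS_tail (hz j hj 0 (by omega))⟩
      · rw [hφ' _ _ hj]; rfl
    rw [this]; exact Q'.zero_mem
  · intro x
    obtain ⟨q, rfl⟩ := h3' x
    choose g hg using fun j => h3 (q.1 j)
    obtain ⟨f, hf⟩ := hbuild (fun j => (g j).1)
    have hfQ : f ∈ Q1 := (hQ1 f).2 fun j hj => by rw [hf j hj]; exact (g j).2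
    have hfφ : ∀ i < d, φ ⟨f, hfQ⟩ i = q.1 i := by
      intro i hi
      rw [hφ _ _ hi, ← hg]
      congr 2
      exact hf i hi
    have hfE : f ∈ EE :=
      (hEE f).2 ⟨hfQ, hcongr q.1 _ (fun i hi => (hfφ i (by omega)).symm) q.2⟩
    refine ⟨⟨f, hfE⟩, ?_⟩
    rw [hπ]
    exact hcongr' _ _ hfφ
  · rintro ⟨f, hfE⟩
    rw [hπ]
    obtain ⟨hfQ, hfφ⟩ := (hEE f).1 hfE
    constructor
    · intro h
      obtain ⟨q, hq, hqf⟩ := (h4' _).1 h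
      simp only at hqf
      have h0 : φ ⟨f, hfQ⟩ 0 = 0 := by rw [← hqf]; rfl
      rw [hφ _ _ (by omega), h4] at h0
      obtain ⟨y, hy, hyf⟩ := h0
      have hf0 : f 0 = 0 := by
        have := congrFun hyf 0
        simpa [hE] using this.symm
      have key := shiftS_tail (R := R) hf0
      set e : ℕ → M := fun n => f (n + 1) with he
      have hec : E c e = y := by
        apply shiftS_inj (R := R)
        rw [← hE0, key, hyf]
      have hej : ∀ j, E j e = E (j + 1) f := by
        intro j; rw [← hEs, key]
      have heQ : e ∈ Q1 := by
        rw [hQ1]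
        intro j hj
        by_cases hjc : j = c
        · rw [hjc, hec]; exact hy
        · rw [hej]; exact (hQ1 _).1 hfQ _ (by omega)
      refine ⟨e, (hEE e).2 ⟨heQ, hcongr q _ ?_ hq⟩, key⟩
      intro i hi
      have := congrFun hqf (i + 1)
      rw [shiftS_succ] at this
      rw [this, hφ _ _ (by omega), hφ _ _ (by omega)]
      congr 2
    · rintro ⟨y, hy, rfl⟩
      obtain ⟨hyQ, hyφ⟩ := (hEE y).1 hy
      rw [hcongr' _ ⟨_, h1' _ hyφ⟩ (fun i hi => hφs ⟨y, hyQ⟩ i hi), h4']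
      exact ⟨_, hyφ, rfl⟩

end

section
variable (k : Type) [Field k]

instance : IsLocalization.AtPrime (DegV k) (tIdeal k) :=
  inferInstanceAs (IsLocalization.AtPrime (Localization.AtPrime (tIdeal k)) (tIdeal k))

instance : IsDomain (DegV k) :=
  IsLocalization.isDomain_localization (M := (tIdeal k).primeCompl) (Ideal.primeCompl_le_nonZeroDivisors _)

instance : IsDedekindDomain (DegV k) :=
  IsLocalization.AtPrime.isDedekindDomain k[X] (tIdeal k) _

instance : IsLocalization (Submonoid.powers (degT k)) (DegK k) :=
  inferInstanceAs (IsLocalization (Submonoid.powers (degT k)) (Localization (Submonoid.powers (degT k))))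
instance : IsScalarTower k (DegV k) (DegK k) :=
  inferInstanceAs (IsScalarTower k (DegV k) (Localization (Submonoid.powers (degT k))))

theorem degT_ne_zero : degT k ≠ 0 := by
  have := IsLocalization.injective (DegV k) (M := (tIdeal k).primeCompl) (Ideal.primeCompl_le_nonZeroDivisors _)
  intro h
  exact Polynomial.X_ne_zero (this (by rw [map_zero]; exact h))

/-- Expansion `V → k[[t]]`. -/
def toPS : DegV k →ₐ[k] PowerSeries k :=
  IsLocalization.liftAlgHom (M := (tIdeal k).primeCompl) (S := DegV k)
    (f := Polynomial.coeToPowerSeries.algHom k (R := k)) (by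
      rintro ⟨y, hy⟩
      rw [PowerSeries.isUnit_iff_constantCoeff]
      have : y.coeff 0 ≠ 0 := fun h => hy (by
        rw [tIdeal]
        exact Ideal.mem_span_singleton.2 (Polynomial.X_dvd_iff.2 h))
      simpa using this)

theorem toPS_poly (p : k[X]) : toPS k (algebraMap k[X] (DegV k) p) = (p : PowerSeries k) := by
  simp [toPS]

theorem toPS_T : toPS k (degT k) = PowerSeries.X := by
  rw [degT, toPS_poly]; simp

/-- Coefficients of the expansion. -/
def cf (n : ℕ) : DegV k →ₗ[k] k := (PowerSeries.coeff n).comp (toPS k).toLinearMap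

theorem cf_T_zero (v : DegV k) : cf k 0 (degT k * v) = 0 := by
  simp [cf, toPS_T]
theorem cf_T_succ (n : ℕ) (v : DegV k) : cf k (n + 1) (degT k * v) = cf k n v := by
  simp [cf, toPS_T, PowerSeries.coeff_succ_X_mul]
theorem cf_zero_one : cf k 0 1 = 1 := by simp [cf]
theorem cf_succ_one (n : ℕ) : cf k (n + 1) 1 = 0 := by simp [cf, PowerSeries.coeff_one]

theorem dvd_of_cf_zero (v : DegV k) (h : cf k 0 v = 0) : ∃ w, degT k * w = v := by
  obtain ⟨⟨p, s⟩, hs⟩ := IsLocalization.surj (tIdeal k).primeCompl v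
  simp only at hs
  have h1 := congrArg (toPS k) hs
  rw [map_mul, toPS_poly, toPS_poly] at h1
  have h2 := congrArg (PowerSeries.coeff 0) h1
  have h0 : PowerSeries.constantCoeff (toPS k v) = 0 := by simpa [cf] using h
  have hp : p.coeff 0 = 0 := by
    simp [h0] at h2
    simpa using h2.symm
  obtain ⟨q, rfl⟩ := Polynomial.X_dvd_iff.2 hp
  have hu := IsLocalization.map_units (DegV k) s
  refine ⟨algebraMap _ _ q * ↑hu.unit⁻¹, ?_⟩
  rw [← mul_assoc, Units.mul_inv_eq_iff_eq_mul]
  rw [map_mul] at hs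
  exact hs.symm

theorem exists_decomp (v : DegV k) : ∃ (c : k) (w : DegV k), v = algebraMap k _ c + degT k * w := by
  obtain ⟨w, hw⟩ := dvd_of_cf_zero k (v - algebraMap k _ (cf k 0 v)) (by
    rw [map_sub, Algebra.algebraMap_eq_smul_one, map_smul, cf_zero_one]; simp)
  exact ⟨cf k 0 v, w, by rw [hw]; ring⟩

variable (M : Type) [AddCommGroup M] [Module k M]

/-- Multiplication by `v` on `M ⊗ V`. -/
abbrev mT (v : DegV k) : M ⊗[k] DegV k →ₗ[k] M ⊗[k] DegV k :=
  LinearMap.lTensor M (LinearMap.mulLeft k v)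
/-- Multiplication by `c` on `M ⊗ K`. -/
abbrev mK (v : DegK k) : M ⊗[k] DegK k →ₗ[k] M ⊗[k] DegK k :=
  LinearMap.lTensor M (LinearMap.mulLeft k v)

theorem mT_mul (v w : DegV k) (x : M ⊗[k] DegV k) : mT k M (v * w) x = mT k M v (mT k M w x) := by
  simp only [mT, LinearMap.mulLeft_mul, LinearMap.lTensor_comp_apply]
theorem mK_mul (v w : DegK k) (x : M ⊗[k] DegK k) : mK k M (v * w) x = mK k M v (mK k M w x) := by
  simp only [mK, LinearMap.mulLeft_mul, LinearMap.lTensor_comp_apply]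
theorem mT_one (x : M ⊗[k] DegV k) : mT k M 1 x = x := by simp [mT]
theorem mK_one (x : M ⊗[k] DegK k) : mK k M 1 x = x := by simp [mK]

theorem mT_injective (v : DegV k) (hv : v ≠ 0) : Function.Injective (mT k M v) :=
  Module.Flat.lTensor_preserves_injective_linearMap _ (fun _ _ h => mul_left_cancel₀ hv h)

/-- The expansion map `M ⊗ V → M[[t]]`. -/
def LL : M ⊗[k] DegV k →ₗ[k] (ℕ → M) :=
  LinearMap.pi fun n => (TensorProduct.rid k M).toLinearMap.comp (LinearMap.lTensor M (cf k n))

theorem LL_tmul (m : M) (v : DegV k) (n : ℕ) : LL k M (m ⊗ₜ v) n = cf k n v • m := by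
  simp [LL]

theorem LL_T_zero (x : M ⊗[k] DegV k) : LL k M (mT k M (degT k) x) 0 = 0 := by
  induction x with
  | zero => simp
  | tmul m v => simp [LL_tmul, cf_T_zero]
  | add x y hx hy => simp only [map_add, Pi.add_apply, hx, hy, add_zero]

theorem LL_T_succ (n : ℕ) (x : M ⊗[k] DegV k) :
    LL k M (mT k M (degT k) x) (n + 1) = LL k M x n := by
  induction x with
  | zero => simp
  | tmul m v => simp [LL_tmul, cf_T_succ]
  | add x y hx hy => simp only [map_add, Pi.add_apply, hx, hy]

theorem LL_T (R : Type) [Ring R] [Module R M] (x : M ⊗[k] DegV k) :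
    LL k M (mT k M (degT k) x) = shiftS R M (LL k M x) := by
  funext n
  cases n with
  | zero => rw [LL_T_zero]; rfl
  | succ n => rw [LL_T_succ]; rfl

theorem LL_end (a : M →ₗ[k] M) (n : ℕ) (x : M ⊗[k] DegV k) :
    LL k M (LinearMap.rTensor _ a x) n = a (LL k M x n) := by
  induction x with
  | zero => simp
  | tmul m v => simp [LL_tmul]
  | add x y hx hy => simp only [map_add, Pi.add_apply, hx, hy]

theorem LL_one_zero (m : M) : LL k M (m ⊗ₜ 1) 0 = m := by simp [LL_tmul, cf_zero_one]
theorem LL_one_succ (m : M) (n : ℕ) : LL k M (m ⊗ₜ 1) (n + 1) = 0 := by simp [LL_tmul, cf_succ_one]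

theorem LL_Tpow_lt (n : ℕ) (x : M ⊗[k] DegV k) (i : ℕ) (hi : i < n) :
    LL k M (mT k M (degT k ^ n) x) i = 0 := by
  induction n generalizing i with
  | zero => omega
  | succ n ih =>
    rw [pow_succ', mT_mul]
    cases i with
    | zero => rw [LL_T_zero]
    | succ i => rw [LL_T_succ]; exact ih i (by omega)

theorem LL_Tpow_add (n : ℕ) (x : M ⊗[k] DegV k) (i : ℕ) :
    LL k M (mT k M (degT k ^ n) x) (n + i) = LL k M x i := by
  induction n with
  | zero => rw [pow_zero, mT_one, zero_add]
  | succ n ih => rw [pow_succ', mT_mul, show n + 1 + i = (n + i) + 1 by ring, LL_T_succ, ih]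

theorem exists_of_LL_zero (x : M ⊗[k] DegV k) (h : LL k M x 0 = 0) :
    ∃ y, mT k M (degT k) y = x := by
  have hex : Function.Exact (LinearMap.mulLeft k (degT k)) (cf k 0) := by
    intro v
    constructor
    · intro h
      exact dvd_of_cf_zero k v h
    · rintro ⟨w, rfl⟩
      exact cf_T_zero k w
  have hs : Function.Surjective (cf k 0) := fun c => ⟨c • 1, by simp [cf_zero_one]⟩
  have := lTensor_exact M hex hs
  refine (this x).1 ?_
  have h' : TensorProduct.rid k M (LinearMap.lTensor M (cf k 0) x) = 0 := h
  exact (LinearEquiv.map_eq_zero_iff _).1 h'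

theorem exists_of_LL_lt (n : ℕ) (x : M ⊗[k] DegV k) (h : ∀ i < n, LL k M x i = 0) :
    ∃ y, mT k M (degT k ^ n) y = x := by
  induction n generalizing x with
  | zero => exact ⟨x, by rw [pow_zero, mT_one]⟩
  | succ n ih =>
    obtain ⟨y, rfl⟩ := exists_of_LL_zero k M x (h 0 (by omega))
    obtain ⟨z, rfl⟩ := ih y (fun i hi => by
      have := h (i + 1) (by omega)
      rwa [LL_T_succ] at this)
    exact ⟨z, by rw [pow_succ', mT_mul]⟩

/-- The inclusion `V → K` as a `k`-linear map. -/
def vk : DegV k →ₗ[k] DegK k := (IsScalarTower.toAlgHom k (DegV k) (DegK k)).toLinearMap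

theorem vk_apply (v : DegV k) : vk k v = algebraMap _ _ v := rfl

theorem vk_injective : Function.Injective (vk k) :=
  IsLocalization.injective (DegK k) (M := Submonoid.powers (degT k)) (by
    rw [Submonoid.powers_le]
    exact mem_nonZeroDivisors_of_ne_zero (degT_ne_zero k))

/-- The inclusion `M ⊗ V → M ⊗ K`. -/
def jj : M ⊗[k] DegV k →ₗ[k] M ⊗[k] DegK k := LinearMap.lTensor M (vk k)

theorem jj_injective : Function.Injective (jj k M) :=
  Module.Flat.lTensor_preserves_injective_linearMap _ (vk_injective k)

theorem jj_mT (v : DegV k) (x : M ⊗[k] DegV k) :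
    jj k M (mT k M v x) = mK k M (algebraMap _ _ v) (jj k M x) := by
  induction x with
  | zero => simp
  | tmul m w => simp [jj, vk_apply]
  | add x y hx hy => simp only [map_add, hx, hy]

theorem jj_end (a : M →ₗ[k] M) (x : M ⊗[k] DegV k) :
    jj k M (LinearMap.rTensor _ a x) = LinearMap.rTensor _ a (jj k M x) := by
  induction x with
  | zero => simp
  | tmul m w => simp [jj]
  | add x y hx hy => simp only [map_add, hx, hy]

theorem mK_end (a : M →ₗ[k] M) (c : DegK k) (x : M ⊗[k] DegK k) :
    mK k M c (LinearMap.rTensor _ a x) = LinearMap.rTensor _ a (mK k M c x) := by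
  induction x with
  | zero => simp
  | tmul m w => simp
  | add x y hx hy => simp only [map_add, hx, hy]

theorem mT_end (a : M →ₗ[k] M) (c : DegV k) (x : M ⊗[k] DegV k) :
    mT k M c (LinearMap.rTensor _ a x) = LinearMap.rTensor _ a (mT k M c x) := by
  induction x with
  | zero => simp
  | tmul m w => simp
  | add x y hx hy => simp only [map_add, hx, hy]

/-- `t` in `K`. -/
abbrev tK : DegK k := algebraMap (DegV k) (DegK k) (degT k)

theorem tK_unit : IsUnit (tK k) :=
  IsLocalization.map_units (DegK k) (⟨degT k, Submonoid.mem_powers _⟩ : Submonoid.powers (degT k))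

theorem mK_injective (c : DegK k) (hc : IsUnit c) : Function.Injective (mK k M c) := by
  obtain ⟨u, rfl⟩ := hc
  intro x y h
  have := congrArg (mK k M ↑u⁻¹) h
  rwa [← mK_mul, ← mK_mul, Units.inv_mul, mK_one, mK_one] at this

theorem exists_jj (x : M ⊗[k] DegK k) : ∃ n y, mK k M (tK k ^ n) x = jj k M y := by
  induction x with
  | zero => exact ⟨0, 0, by simp⟩
  | tmul m w =>
    obtain ⟨⟨v, ⟨_, n, rfl⟩⟩, hs⟩ := IsLocalization.surj (Submonoid.powers (degT k)) w
    refine ⟨n, m ⊗ₜ v, ?_⟩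
    simp only [map_pow] at hs
    simp [jj, vk_apply, ← hs, mul_comm]
  | add x y hx hy =>
    obtain ⟨n, x', hx⟩ := hx
    obtain ⟨m, y', hy⟩ := hy
    refine ⟨m + n, mT k M (degT k ^ m) x' + mT k M (degT k ^ n) y', ?_⟩
    rw [map_add, map_add, jj_mT, jj_mT, ← hx, ← hy, ← mK_mul, ← mK_mul, map_pow, map_pow,
      ← pow_add, ← pow_add, add_comm n m]
end

section
variable (k : Type) [Field k] (M : Type) [AddCommGroup M] [Module k M]
  (Q : Type) [AddCommGroup Q] [Module (DegV k) Q]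

theorem smul_mk_one (v : DegV k) (q : Q) :
    (LocalizedModule.mk (v • q) 1 : LocalizedModule (Submonoid.powers (degT k)) Q) =
      algebraMap (DegV k) (DegK k) v • LocalizedModule.mk q 1 := by
  have h : algebraMap (DegV k) (DegK k) v =
    (Localization.mk v 1 : Localization (Submonoid.powers (degT k))) :=
      (Localization.mk_one_eq_algebraMap v).symm
  rw [h]
  refine Eq.trans ?_ (LocalizedModule.mk_smul_mk v q 1 1).symm
  rw [one_mul]

theorem smul_mk_pow (s : Submonoid.powers (degT k)) (q : Q) :
    algebraMap (DegV k) (DegK k) s • 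
      (LocalizedModule.mk q s : LocalizedModule (Submonoid.powers (degT k)) Q) =
      LocalizedModule.mk q 1 := by
  have h : algebraMap (DegV k) (DegK k) s =
    (Localization.mk (s : DegV k) 1 : Localization (Submonoid.powers (degT k))) :=
      (Localization.mk_one_eq_algebraMap _).symm
  rw [h]
  refine Eq.trans (LocalizedModule.mk_smul_mk (s : DegV k) q 1 s) ?_
  rw [one_mul]
  exact LocalizedModule.mk_cancel s q

theorem map_mk_one (A : Q →ₗ[DegV k] Q) (q : Q) (s : Submonoid.powers (degT k)) :
    LocalizedModule.map (Submonoid.powers (degT k)) A (LocalizedModule.mk q s) =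
      LocalizedModule.mk (A q) s := by
  rw [LocalizedModule.map_mk]

variable {k M Q} in
theorem loc_forward (f : LocalizedModule (Submonoid.powers (degT k)) Q ≃+ (M ⊗[k] DegK k))
    (hf : ∀ (c : DegK k) (x : LocalizedModule (Submonoid.powers (degT k)) Q),
          f (c • x) = LinearMap.lTensor M (LinearMap.mulLeft k c) (f x)) :
    ∃ g : Q →+ M ⊗[k] DegK k, (∀ q, g q = f (LocalizedModule.mk q 1)) ∧
      (∀ (v : DegV k) q, g (v • q) = mK k M (algebraMap _ _ v) (g q)) ∧
      (∀ x, ∃ n q, mK k M (tK k ^ n) x = g q) ∧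
      (∀ q, g q = 0 → ∃ n, degT k ^ n • q = 0) := by
  refine ⟨f.toAddMonoidHom.comp
    (LocalizedModule.mkLinearMap (Submonoid.powers (degT k)) Q).toAddMonoidHom,
    fun q => rfl, ?_, ?_, ?_⟩
  · intro v q
    change f (LocalizedModule.mk (v • q) 1) = mK k M _ (f (LocalizedModule.mk q 1))
    rw [smul_mk_one, hf]
  · intro x
    obtain ⟨y, rfl⟩ := f.surjective x
    induction y with
    | h q s =>
      obtain ⟨_, n, rfl⟩ := s
      refine ⟨n, q, ?_⟩
      rw [← map_pow]
      refine (hf _ _).symm.trans ?_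
      exact congrArg f (smul_mk_pow k Q ⟨degT k ^ n, n, rfl⟩ q)
  · intro q hq
    have h1 : f (LocalizedModule.mk q 1) = f 0 := by rw [map_zero]; exact hq
    have h2 := f.injective h1
    rw [← LocalizedModule.zero_mk 1, LocalizedModule.mk_eq] at h2
    obtain ⟨⟨_, n, rfl⟩, hu⟩ := h2
    refine ⟨n, ?_⟩
    simpa [Submonoid.smul_def] using hu

variable {k M Q} in
theorem loc_backward (g : Q →+ M ⊗[k] DegK k)
      (hg : ∀ (v : DegV k) q, g (v • q) = mK k M (algebraMap _ _ v) (g q))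
      (hsurj : ∀ x, ∃ n q, mK k M (tK k ^ n) x = g q)
      (hinj : ∀ q, g q = 0 → q = 0) :
    ∃ f : LocalizedModule (Submonoid.powers (degT k)) Q ≃+ (M ⊗[k] DegK k),
      (∀ (c : DegK k) (x : LocalizedModule (Submonoid.powers (degT k)) Q),
          f (c • x) = LinearMap.lTensor M (LinearMap.mulLeft k c) (f x)) ∧
      (∀ (A : Q →ₗ[DegV k] Q) (a : M →ₗ[k] M), 
        (∀ q, g (A q) = LinearMap.rTensor (DegK k) a (g q)) →
        ∀ x, f (LocalizedModule.map (Submonoid.powers (degT k)) A x) = 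
          LinearMap.rTensor (DegK k) a (f x)) := by
  let _ : Module (DegV k) (M ⊗[k] DegK k) := Module.compHom _
    ((Module.End.lTensorAlgHom k (DegK k) M).toRingHom.comp
      ((Algebra.lmul k (DegK k)).toRingHom.comp (algebraMap (DegV k) (DegK k))))
  have hsm : ∀ (v : DegV k) (x : M ⊗[k] DegK k), v • x = mK k M (algebraMap _ _ v) x :=
    fun v x => rfl
  let G : Q →ₗ[DegV k] M ⊗[k] DegK k := { g with map_smul' := hg }
  have hG : ∀ q, G q = g q := fun q => rfl
  have hunit : ∀ x : Submonoid.powers (degT k), 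
      IsUnit (algebraMap (DegV k) (Module.End (DegV k) (M ⊗[k] DegK k)) x) := by
    intro s
    rw [Module.End.isUnit_iff]
    have hu : IsUnit (algebraMap (DegV k) (DegK k) s) := IsLocalization.map_units (DegK k) s
    refine ⟨mK_injective k M _ hu, fun y => ?_⟩
    refine ⟨mK k M ↑hu.unit⁻¹ y, ?_⟩
    change mK k M _ _ = y
    rw [← mK_mul, IsUnit.mul_val_inv, mK_one]
  have hloc : IsLocalizedModule (Submonoid.powers (degT k)) G := by
    refine ⟨hunit, ?_, ?_⟩
    · intro y
      obtain ⟨n, q, h⟩ := hsurj y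
      refine ⟨⟨q, ⟨degT k ^ n, n, rfl⟩⟩, ?_⟩
      rw [Submonoid.smul_def, hsm, hG, ← h, map_pow]
    · intro x y h
      refine ⟨1, ?_⟩
      have : x - y = 0 := hinj _ (by rw [map_sub, ← hG, ← hG, h, sub_self])
      rw [sub_eq_zero.1 this]
  let F := IsLocalizedModule.iso (Submonoid.powers (degT k)) G
  have key : ∀ (q : Q) (s : Submonoid.powers (degT k)),
      mK k M (algebraMap _ _ (s : DegV k)) (F (LocalizedModule.mk q s)) = g q := by
    intro q s
    rw [← hsm, ← map_smul, ← hG]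
    have : (s : DegV k) • LocalizedModule.mk q s = LocalizedModule.mk q 1 := by
      rw [LocalizedModule.smul'_mk]; exact LocalizedModule.mk_cancel s q
    rw [this, IsLocalizedModule.iso_apply_mk]
    simp
  have hmu : ∀ (s : Submonoid.powers (degT k)), IsUnit (algebraMap (DegV k) (DegK k) s) :=
    fun s => IsLocalization.map_units (DegK k) s
  refine ⟨F.toAddEquiv, ?_, ?_⟩
  · intro c x
    change F (c • x) = mK k M c (F x)
    induction x with
    | h q s =>
      obtain ⟨⟨v, u⟩, hv⟩ := IsLocalization.surj (Submonoid.powers (degT k)) c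
      simp only at hv
      have hc : c = (Localization.mk v u : Localization (Submonoid.powers (degT k))) := by
        rw [Localization.mk_eq_mk']
        exact (IsLocalization.eq_mk'_iff_mul_eq (M := Submonoid.powers (degT k))
          (S := Localization (Submonoid.powers (degT k)))).2 hv
      have h1 : c • (LocalizedModule.mk q s : LocalizedModule (Submonoid.powers (degT k)) Q)
          = LocalizedModule.mk (v • q) (u * s) := by
        rw [hc]; exact LocalizedModule.mk_smul_mk v q u s
      rw [h1]
      apply mK_injective k M _ (hmu (u * s))
      rw [key, hg, ← key q s, ← mK_mul, ← mK_mul, ← hv]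
      congr 2
      simp only [Submonoid.coe_mul, map_mul]
      ring
  · intro A a hA x
    change F _ = LinearMap.rTensor _ a (F x)
    induction x with
    | h q s =>
      rw [map_mk_one]
      apply mK_injective k M _ (hmu s)
      rw [key, mK_end, key, hA]
end

section
variable {R M N A : Type} [Ring R] [AddCommGroup M] [Module R M] [AddCommGroup N] [Module R N]
  [AddCommGroup A] [Module R A]

theorem Crit.of_map (τ : A → A) (G : A →ₗ[R] (ℕ → M)) (p : A →ₗ[R] N)
    (hp : Function.Surjective p) (hk : ∀ a, p a = 0 ↔ ∃ a', τ a' = a)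
    (hτ : ∀ a, G (τ a) = shiftS R M (G a)) (b : ℕ)
    (h1 : ∀ a, (∀ i < b + 1, G a i = 0) → p a = 0)
    (h2 : ∀ f : ℕ → M, (∀ i < b, f i = 0) → ∃ a, ∀ i < b + 1, G a i = f i) : Crit R M N := by
  let Z : Submodule R (ℕ → M) :=
    { carrier := {f | ∀ i < b + 1, f i = 0}
      add_mem' := by
        intro f g hf hg i hi
        simp [hf i hi, hg i hi]
      zero_mem' := by intro i _; rfl
      smul_mem' := by
        intro r f hf i hi
        simp [hf i hi] }
  have hZ : ∀ f, f ∈ Z ↔ ∀ i < b + 1, f i = 0 := fun f => Iff.rfl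
  let h : A × Z →ₗ[R] (ℕ → M) := G.coprod Z.subtype
  have hh : ∀ a z, h (a, z) = G a + z.1 := fun a z => by simp [h]
  let p0 : A × Z →ₗ[R] N := p.comp (LinearMap.fst R A Z)
  have hker : LinearMap.ker h ≤ LinearMap.ker p0 := by
    rintro ⟨a, z⟩ hx
    rw [LinearMap.mem_ker, hh] at hx
    rw [LinearMap.mem_ker]
    apply h1
    intro i hi
    have := congrFun hx i
    simpa [z.2 i hi] using this
  let p' : LinearMap.range h →ₗ[R] N :=
    ((LinearMap.ker h).liftQ p0 hker).comp h.quotKerEquivRange.symm.toLinearMap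
  have hp' : ∀ x (hx : h x ∈ LinearMap.range h), p' ⟨h x, hx⟩ = p x.1 := by
    intro x hx
    have : h.quotKerEquivRange.symm ⟨h x, hx⟩ = Submodule.Quotient.mk x := by
      rw [LinearEquiv.symm_apply_eq]; rfl
    simp only [p', LinearMap.comp_apply, LinearEquiv.coe_coe, this]
    rfl
  have hmem : ∀ f, (∀ i < b, f i = 0) → f ∈ LinearMap.range h := by
    intro f hf
    obtain ⟨a, ha⟩ := h2 f hf
    refine ⟨(a, ⟨f - G a, fun i hi => by simp [ha i hi]⟩), ?_⟩
    rw [hh]; simp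
  have hsZ : ∀ z ∈ Z, shiftS R M z ∈ Z := by
    intro z hz i hi
    cases i with
    | zero => rfl
    | succ i => exact hz i (by omega)
  have hsh : ∀ a (z : Z), shiftS R M (h (a, z)) = h (τ a, ⟨_, hsZ z z.2⟩) := by
    intro a z
    rw [hh, hh, hτ, map_add]
  refine ⟨b, LinearMap.range h, p', ?_, hmem, ?_, ?_⟩
  · rintro _ ⟨⟨a, z⟩, rfl⟩
    rw [hsh]
    exact ⟨_, rfl⟩
  · intro n
    obtain ⟨a, rfl⟩ := hp n
    exact ⟨⟨h (a, 0), _, rfl⟩, hp' _ _⟩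
  · rintro ⟨_, ⟨a, z⟩, rfl⟩
    have hax : h (a, z) ∈ LinearMap.range h := ⟨_, rfl⟩
    change p' ⟨h (a, z), hax⟩ = 0 ↔ ∃ y ∈ LinearMap.range h, shiftS R M y = h (a, z)
    rw [hp', hk]
    constructor
    · rintro ⟨a', rfl⟩
      refine ⟨G a' + fun n => z.1 (n + 1), ?_, ?_⟩
      · refine Submodule.add_mem _ ⟨(a', 0), by rw [hh]; simp⟩ (hmem _ fun i hi => ?_)
        exact z.2 _ (by omega)
      · rw [map_add, shiftS_tail (z.2 0 (by omega)), hh, hτ]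
    · rintro ⟨_, ⟨⟨a', z'⟩, rfl⟩, hy⟩
      rw [← hk]
      have h5 := hp' (a, z) ⟨_, rfl⟩
      rw [← h5]
      have h6 := hp' (τ a', ⟨_, hsZ z' z'.2⟩) ⟨_, rfl⟩
      have h7 : p (τ a') = 0 := (hk _).2 ⟨_, rfl⟩
      rw [h7] at h6
      rw [← h6]
      congr 1
      exact Subtype.ext (hy.symm.trans (hsh a' z'))
end

section
variable (k : Type) [Field k] (R : Type) [Ring R] [Algebra k R]
variable {M N : Type} [AddCommGroup M] [Module R M] [AddCommGroup N] [Module R N]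

theorem tensor_split (r : R) (v : DegV k) :
    r ⊗ₜ[k] v = (r ⊗ₜ[k] (1 : DegV k)) * ((1 : R) ⊗ₜ[k] v) := by
  simp [Algebra.TensorProduct.tmul_mul_tmul]

theorem crit_of_deg [Module.Finite R M] (h : Degenerates k R M N) : Crit R M N := by
  obtain ⟨Q, _, _, hfin, hflat, he, hloc⟩ := h
  let _ := vRestrict k R Q
  let _ : Module R Q := rRestrict k R Q
  let _ := rRestrict k R (Q ⧸ LinearMap.range (tSmul k R Q))
  let _ : Module k M := Module.compHom M (algebraMap k R)
  obtain ⟨e⟩ := he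
  obtain ⟨f, hf, hr⟩ := hloc
  obtain ⟨g, hgf, hgv, hgs, hgi⟩ := loc_forward f hf
  have hvdef : ∀ (v : DegV k) (q : Q), v • q = ((1 : R) ⊗ₜ[k] v) • q := fun v q => rfl
  have hrdef : ∀ (r : R) (q : Q), r • q = (r ⊗ₜ[k] (1 : DegV k)) • q := fun v q => rfl
  have htens : ∀ (r : R) (v : DegV k) (q : Q), (r ⊗ₜ[k] v) • q = r • (v • q) := by
    intro r v q
    rw [tensor_split, mul_smul]; rfl
  have hgr : ∀ (r : R) (q : Q), g (r • q) = LinearMap.rTensor (DegK k) (rActK k R M r) (g q) := by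
    intro r q
    rw [hgf, hgf, ← hr, map_mk_one]
    rfl
  have hgi' : ∀ q, g q = 0 → q = 0 := by
    intro q hq
    obtain ⟨n, hn⟩ := hgi q hq
    have : Module.IsTorsionFree (DegV k) Q := @Module.Flat.isTorsionFree _ _ _ _ _ hflat
    exact (smul_eq_zero.1 hn).resolve_left (pow_ne_zero _ (degT_ne_zero k))
  have hmono : ∀ (n m : ℕ) (x : M ⊗[k] DegK k), n ≤ m → (∃ y, mK k M (tK k ^ n) x = jj k M y) →
      (∃ y, mK k M (tK k ^ m) x = jj k M y) := by
    rintro n m x hnm ⟨y, hy⟩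
    refine ⟨mT k M (degT k ^ (m - n)) y, ?_⟩
    rw [jj_mT, ← hy, ← mK_mul, map_pow, ← pow_add, Nat.sub_add_cancel hnm]
  -- step a
  obtain ⟨a, ha⟩ : ∃ a, ∀ q, ∃ y, mK k M (tK k ^ a) (g q) = jj k M y := by
    obtain ⟨S, hS⟩ := hfin.fg_top
    choose n y hy using fun q => exists_jj k M (g q)
    refine ⟨S.sup n, fun q => ?_⟩
    have hq : q ∈ Submodule.span (R ⊗[k] DegV k) (S : Set Q) := by rw [hS]; trivial
    induction hq using Submodule.span_induction with
    | mem x hx => exact hmono _ _ _ (Finset.le_sup hx) ⟨_, hy x⟩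
    | zero => exact ⟨0, by simp⟩
    | add x z _ _ hx hz =>
      obtain ⟨x', hx⟩ := hx
      obtain ⟨z', hz⟩ := hz
      exact ⟨x' + z', by rw [map_add, map_add, map_add, hx, hz]⟩
    | smul s x _ hx =>
      obtain ⟨x', hx⟩ := hx
      induction s with
      | zero => exact ⟨0, by simp⟩
      | tmul r v =>
        refine ⟨LinearMap.rTensor _ (rActK k R M r) (mT k M v x'), ?_⟩
        rw [htens, hgr, hgv, jj_end, jj_mT, ← hx, mK_end, ← mK_mul, ← mK_mul, mul_comm]
      | add s s' hs hs' =>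
        obtain ⟨x', hx⟩ := hs
        obtain ⟨z', hz⟩ := hs'
        exact ⟨x' + z', by rw [add_smul, map_add, map_add, map_add, hx, hz]⟩
  -- step b
  obtain ⟨b, hb⟩ : ∃ b, ∀ y, ∃ q, mK k M (tK k ^ b) (jj k M y) = g q := by
    obtain ⟨S, hS⟩ := (inferInstance : Module.Finite R M).fg_top
    choose n q hq using fun m : M => hgs (jj k M (m ⊗ₜ 1))
    have h1 : ∀ m : M, ∃ q, mK k M (tK k ^ (S.sup n)) (jj k M (m ⊗ₜ 1)) = g q := by
      intro m
      have hm : m ∈ Submodule.span R (S : Set M) := by rw [hS]; trivial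
      induction hm using Submodule.span_induction with
      | mem x hx =>
        refine ⟨degT k ^ (S.sup n - n x) • q x, ?_⟩
        rw [hgv, ← hq x, ← mK_mul, map_pow, ← pow_add, Nat.sub_add_cancel (Finset.le_sup hx)]
      | zero => exact ⟨0, by simp⟩
      | add x z _ _ hx hz =>
        obtain ⟨x', hx⟩ := hx
        obtain ⟨z', hz⟩ := hz
        exact ⟨x' + z', by rw [add_tmul, map_add, map_add, map_add, hx, hz]⟩
      | smul r x _ hx =>
        obtain ⟨x', hx⟩ := hx
        refine ⟨r • x', ?_⟩
        rw [hgr, ← hx, ← mK_end, ← jj_end]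
        rfl
    refine ⟨S.sup n, fun y => ?_⟩
    induction y with
    | zero => exact ⟨0, by simp⟩
    | tmul m v =>
      obtain ⟨q, hq⟩ := h1 m
      refine ⟨v • q, ?_⟩
      rw [hgv, ← hq, ← mK_mul, mul_comm, mK_mul, ← jj_mT]
      simp
    | add x z hx hz =>
      obtain ⟨x', hx⟩ := hx
      obtain ⟨z', hz⟩ := hz
      exact ⟨x' + z', by rw [map_add, map_add, map_add, hx, hz]⟩
  choose H hH using ha
  have hHadd : ∀ x y, H (x + y) = H x + H y := by
    intro x y
    apply jj_injective k M
    rw [map_add, ← hH, ← hH, ← hH, map_add, map_add]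
  have hHr : ∀ (r : R) x, H (r • x) = LinearMap.rTensor _ (rActK k R M r) (H x) := by
    intro r x
    apply jj_injective k M
    rw [jj_end, ← hH, ← hH, hgr, mK_end]
  have hHv : ∀ (v : DegV k) x, H (v • x) = mT k M v (H x) := by
    intro r x
    apply jj_injective k M
    rw [jj_mT, ← hH, ← hH, hgv, ← mK_mul, ← mK_mul, mul_comm]
  have hHinj : ∀ x y, H x = H y → x = y := by
    intro x y hxy
    rw [← sub_eq_zero]
    apply hgi'
    rw [map_sub, sub_eq_zero]
    apply mK_injective k M (tK k ^ a) ((tK_unit k).pow a)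
    rw [hH, hH, hxy]
  have hHs : ∀ y, ∃ q, mT k M (degT k ^ (a + b)) y = H q := by
    intro y
    obtain ⟨q, hq⟩ := hb y
    refine ⟨q, ?_⟩
    apply jj_injective k M
    rw [jj_mT, map_pow, pow_add, mK_mul, hq, hH]
  let G : Q →ₗ[R] (ℕ → M) :=
    { toFun := fun q => LL k M (H q)
      map_add' := fun x y => by rw [hHadd, map_add]
      map_smul' := fun r x => by
        rw [hHr]; funext n; rw [LL_end]; rfl }
  have hG : ∀ q, G q = LL k M (H q) := fun q => rfl
  let p : Q →ₗ[R] N :=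
    { toFun := fun q => e (Submodule.Quotient.mk q)
      map_add' := fun x y => by rw [Submodule.Quotient.mk_add, map_add]
      map_smul' := fun r x => by
        rw [RingHom.id_apply, ← map_smul]
        rfl }
  have hpz : ∀ q, p q = 0 ↔ ∃ q', degT k • q' = q := by
    intro q
    have : p q = 0 ↔ (Submodule.Quotient.mk q : Q ⧸ LinearMap.range (tSmul k R Q)) = 0 :=
      LinearEquiv.map_eq_zero_iff e
    rw [this, Submodule.Quotient.mk_eq_zero]
    rfl
  refine Crit.of_map (fun q => degT k • q) G p ?_ hpz ?_ (a + b) ?_ ?_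
  · intro n
    obtain ⟨x, hx⟩ := e.surjective n
    obtain ⟨q, rfl⟩ := Submodule.Quotient.mk_surjective _ x
    exact ⟨q, hx⟩
  · intro q
    rw [hG, hHv, LL_T k M R]; rfl
  · intro q hq
    obtain ⟨y, hy⟩ := exists_of_LL_lt k M _ _ hq
    obtain ⟨q', hq'⟩ := hHs y
    rw [hpz]
    refine ⟨q', ?_⟩
    apply hHinj
    rw [hHv, ← hq', ← hy, pow_succ', mT_mul]
  · intro F hF
    obtain ⟨q, hq⟩ := hHs (F (a + b) ⊗ₜ 1)
    refine ⟨q, fun i hi => ?_⟩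
    rw [hG, ← hq]
    rcases Nat.lt_succ_iff_lt_or_eq.1 hi with hi | rfl
    · rw [LL_Tpow_lt _ _ _ _ _ hi, hF i hi]
    · have := LL_Tpow_add k M (a + b) (F (a + b) ⊗ₜ 1) 0
      rw [add_zero, LL_one_zero] at this
      exact this

end

section
variable (k : Type) [Field k] (R : Type) [Ring R] [Algebra k R]
variable {M N : Type} [AddCommGroup M] [Module R M] [AddCommGroup N] [Module R N]

theorem deg_of_crit [Module.Finite R M] [Module.Finite R N] (h : Crit R M N) :
    Degenerates k R M N := by
  obtain ⟨b, L, p, h1, h2, h3, h4⟩ := h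
  let _ : Module k M := Module.compHom M (algebraMap k R)
  have : IsScalarTower k R M := IsScalarTower.of_algebraMap_smul fun c m => rfl
  have hkM : ∀ (c : k) (m : M), c • m = algebraMap k R c • m := fun c m => rfl
  -- the module structure on `M ⊗ V`
  let ρ : R ⊗[k] DegV k →ₐ[k] Module.End k (M ⊗[k] DegV k) :=
    (Module.endTensorEndAlgHom (R := k) (S := k) (A := k) (M := M) (N := DegV k)).comp
      (Algebra.TensorProduct.map (Algebra.lsmul k k M : R →ₐ[k] Module.End k M)
        (Algebra.lmul k (DegV k)))
  have hρ : ∀ (r : R) (v : DegV k) (x : M ⊗[k] DegV k),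
      ρ (r ⊗ₜ v) x = LinearMap.rTensor _ (rActK k R M r) (mT k M v x) := by
    intro r v x
    induction x with
    | zero => simp
    | tmul m w =>
      simp [ρ, rActK]
      rfl
    | add x y hx hy => rw [map_add, hx, hy, map_add, map_add]
  let _ : Module (R ⊗[k] DegV k) (M ⊗[k] DegV k) := Module.compHom _ ρ.toRingHom
  have hsm : ∀ (r : R) (v : DegV k) (x : M ⊗[k] DegV k),
      (r ⊗ₜ[k] v) • x = LinearMap.rTensor _ (rActK k R M r) (mT k M v x) := hρ
  have hid : rActK k R M (1 : R) = LinearMap.id := by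
    ext m; simp [rActK]
  have hsmv : ∀ (v : DegV k) (x : M ⊗[k] DegV k),
      ((1 : R) ⊗ₜ[k] v) • x = mT k M v x := by
    intro v x
    rw [hsm, hid, LinearMap.rTensor_id, LinearMap.id_apply]
  have hsmr : ∀ (r : R) (x : M ⊗[k] DegV k),
      (r ⊗ₜ[k] (1 : DegV k)) • x = LinearMap.rTensor _ (rActK k R M r) x := by
    intro r x
    rw [hsm, mT_one]
  -- closure properties
  have hLr : ∀ (r : R) x, LL k M (LinearMap.rTensor _ (rActK k R M r) x) = r • LL k M x := by
    intro r x
    funext n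
    rw [LL_end]; rfl
  have hLk : ∀ (c : k) x, LL k M (c • x) = algebraMap k R c • LL k M x := by
    intro c x
    rw [map_smul]
    rfl
  have hT : ∀ x, LL k M (mT k M (degT k) x) = shiftS R M (LL k M x) := LL_T k M R
  have hpow : ∀ x, LL k M (mT k M (degT k ^ b) x) ∈ L := fun x =>
    h2 _ fun i hi => LL_Tpow_lt k M b x i hi
  have hLv : ∀ x, LL k M x ∈ L → ∀ v, LL k M (mT k M v x) ∈ L := by
    intro x hx
    have : ∀ n v, ∃ y z, mT k M v x = y + mT k M (degT k ^ n) z ∧ LL k M y ∈ L := by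
      intro n
      induction n with
      | zero => intro v; exact ⟨0, mT k M v x, by rw [pow_zero, mT_one, zero_add], by simp⟩
      | succ n ih =>
        intro v
        obtain ⟨c, w, rfl⟩ := exists_decomp k v
        obtain ⟨y, z, hyz, hy⟩ := ih w
        refine ⟨c • x + mT k M (degT k) y, z, ?_, ?_⟩
        · rw [pow_succ', mT_mul, add_assoc, ← map_add, ← hyz, ← mT_mul]
          have h8 : LinearMap.mulLeft k (algebraMap k (DegV k) c + degT k * w) =
              c • LinearMap.id + LinearMap.mulLeft k (degT k * w) := by
            ext; simp [add_mul, mul_assoc, Algebra.smul_def]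
          simp only [mT]
          rw [h8, LinearMap.lTensor_add, LinearMap.lTensor_smul]
          simp
        · rw [map_add, hLk, hT]
          exact L.add_mem (L.smul_mem _ hx) (h1 _ hy)
    intro v
    obtain ⟨y, z, hyz, hy⟩ := this b v
    rw [hyz, map_add]
    exact L.add_mem hy (hpow z)
  let Q : Submodule (R ⊗[k] DegV k) (M ⊗[k] DegV k) :=
    { carrier := {x | LL k M x ∈ L}
      add_mem' := fun {x y} hx hy => by
        simp only [Set.mem_setOf_eq, map_add] at *
        exact L.add_mem hx hy
      zero_mem' := by simp
      smul_mem' := fun s x hx => by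
        simp only [Set.mem_setOf_eq] at *
        induction s with
        | zero => simp
        | tmul r v => rw [hsm, hLr]; exact L.smul_mem _ (hLv _ hx _)
        | add s t hs ht => rw [add_smul, map_add]; exact L.add_mem hs ht }
  have hQ : ∀ x, x ∈ Q ↔ LL k M x ∈ L := fun x => Iff.rfl
  let PP : Q →+ N :=
    { toFun := fun x => p ⟨LL k M x.1, x.2⟩
      map_zero' := by
        exact (congrArg p (Subtype.ext (by simp))).trans (map_zero p)
      map_add' := fun x y => by
        rw [← map_add p]; congr 1; exact Subtype.ext (by simp) }
  have hPP : ∀ x : Q, PP x = p ⟨LL k M x.1, x.2⟩ := fun x => rfl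
  have hPPr : ∀ (r : R) (x : Q), PP ((r ⊗ₜ[k] (1 : DegV k)) • x) = r • PP x := by
    intro r x
    rw [hPP, hPP, ← map_smul p]
    congr 1
    apply Subtype.ext
    change LL k M ((r ⊗ₜ[k] (1 : DegV k)) • x.1) = r • LL k M x.1
    rw [hsmr, hLr]
  have hPPz : ∀ x : Q, PP x = 0 ↔ ∃ y : Q, ((1 : R) ⊗ₜ[k] degT k) • y = x := by
    intro x
    rw [hPP, h4]
    constructor
    · rintro ⟨y, hy, hyx⟩
      obtain ⟨z, hz⟩ := exists_of_LL_zero k M x.1 (by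
        have := congrFun hyx 0
        rw [shiftS_zero] at this
        exact this.symm)
      have hzy : LL k M z = y := by
        apply shiftS_inj (R := R)
        rw [← hT, hz, hyx]
      refine ⟨⟨z, by rw [hQ, hzy]; exact hy⟩, Subtype.ext ?_⟩
      change ((1 : R) ⊗ₜ[k] degT k) • z = x.1
      rw [hsmv, hz]
    · rintro ⟨y, rfl⟩
      refine ⟨LL k M y.1, y.2, ?_⟩
      change _ = LL k M (((1 : R) ⊗ₜ[k] degT k) • y.1)
      rw [hsmv, hT]
  have happrox : ∀ (n : ℕ) (f : ℕ → M), ∃ x, ∀ i < n, LL k M x i = f i := by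
    intro n
    induction n with
    | zero => intro f; exact ⟨0, fun i hi => by omega⟩
    | succ n ih =>
      intro f
      obtain ⟨y, hy⟩ := ih (fun i => f (i + 1))
      refine ⟨f 0 ⊗ₜ 1 + mT k M (degT k) y, fun i hi => ?_⟩
      rw [map_add, Pi.add_apply]
      cases i with
      | zero => rw [LL_one_zero, LL_T_zero, add_zero]
      | succ i => rw [LL_one_succ, LL_T_succ, zero_add, hy i (by omega)]
  have hPPs : Function.Surjective PP := by
    intro n
    obtain ⟨f, rfl⟩ := h3 n
    obtain ⟨x, hx⟩ := happrox (b + 1) f.1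
    have hxQ : x ∈ Q := by
      rw [hQ]
      have : LL k M x - f.1 ∈ L := h2 _ fun i hi => by simp [hx i (by omega)]
      simpa using L.add_mem this f.2
    refine ⟨⟨x, hxQ⟩, ?_⟩
    rw [hPP, ← sub_eq_zero, ← map_sub, h4]
    refine ⟨fun i => (LL k M x - f.1) (i + 1), h2 _ fun i hi => by simp [hx (i + 1) (by omega)],
      shiftS_tail (by simp [hx 0 (by omega)])⟩
  refine ⟨Q, inferInstance, inferInstance, ?_, ?_, ?_, ?_⟩
  · -- finite generation
    obtain ⟨SN, hSN⟩ := (inferInstance : Module.Finite R N).fg_top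
    obtain ⟨SM, hSM⟩ := (inferInstance : Module.Finite R M).fg_top
    choose u hu using hPPs
    let z : M → Q := fun m => ⟨mT k M (degT k ^ b) (m ⊗ₜ 1), hpow _⟩
    let S : Submodule (R ⊗[k] DegV k) Q :=
      Submodule.span _ (u '' (SN : Set N) ∪ z '' (SM : Set M))
    have c0 : ∀ n, ∃ s ∈ S, PP s = n := by
      intro n
      have hn : n ∈ Submodule.span R (SN : Set N) := by rw [hSN]; trivial
      induction hn using Submodule.span_induction with
      | mem x hx => exact ⟨u x, Submodule.subset_span (Or.inl ⟨x, hx, rfl⟩), hu x⟩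
      | zero => exact ⟨0, S.zero_mem, map_zero _⟩
      | add x y _ _ hx hy =>
        obtain ⟨x', hx', rfl⟩ := hx
        obtain ⟨y', hy', rfl⟩ := hy
        exact ⟨_, S.add_mem hx' hy', map_add _ _ _⟩
      | smul r x _ hx =>
        obtain ⟨x', hx', rfl⟩ := hx
        exact ⟨_, S.smul_mem _ hx', hPPr r x'⟩
    have c2 : ∀ n (x : Q), ∃ s ∈ S, ∃ y : Q, x = s + ((1 : R) ⊗ₜ[k] (degT k ^ n)) • y := by
      intro n
      induction n with
      | zero =>
        intro x
        refine ⟨0, S.zero_mem, x, ?_⟩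
        rw [pow_zero, zero_add]
        exact (one_smul (R ⊗[k] DegV k) x).symm
      | succ n ih =>
        intro x
        obtain ⟨s, hs, hsx⟩ := c0 (PP x)
        obtain ⟨y, hy⟩ := (hPPz (x - s)).1 (by rw [map_sub, hsx, sub_self])
        obtain ⟨s', hs', y', hy'⟩ := ih y
        refine ⟨s + ((1 : R) ⊗ₜ[k] degT k) • s', S.add_mem hs (S.smul_mem _ hs'), y', ?_⟩
        have h9 : (1 : R) ⊗ₜ[k] (degT k ^ (n + 1)) =
            ((1 : R) ⊗ₜ[k] degT k) * ((1 : R) ⊗ₜ[k] (degT k ^ n)) := by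
          rw [Algebra.TensorProduct.tmul_mul_tmul, one_mul, pow_succ']
        rw [h9, mul_smul, add_assoc, ← smul_add, ← hy', hy]
        abel
    have c3 : ∀ m : M, z m ∈ S := by
      intro m
      have hm : m ∈ Submodule.span R (SM : Set M) := by rw [hSM]; trivial
      induction hm using Submodule.span_induction with
      | mem x hx => exact Submodule.subset_span (Or.inr ⟨x, hx, rfl⟩)
      | zero =>
        have : z 0 = 0 := Subtype.ext (by simp [z])
        rw [this]; exact S.zero_mem
      | add x y _ _ hx hy =>
        have : z (x + y) = z x + z y := Subtype.ext (by simp [z, add_tmul])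
        rw [this]; exact S.add_mem hx hy
      | smul r x _ hx =>
        have : z (r • x) = (r ⊗ₜ[k] (1 : DegV k)) • z x := by
          apply Subtype.ext
          change mT k M (degT k ^ b) ((r • x) ⊗ₜ 1) =
            (r ⊗ₜ[k] (1 : DegV k)) • mT k M (degT k ^ b) (x ⊗ₜ 1)
          rw [hsmr, ← mT_end]
          rfl
        rw [this]; exact S.smul_mem _ hx
    have c4 : ∀ w : M ⊗[k] DegV k, (⟨mT k M (degT k ^ b) w, hpow _⟩ : Q) ∈ S := by
      intro w
      induction w with
      | zero =>
        have : (⟨mT k M (degT k ^ b) 0, hpow _⟩ : Q) = 0 := Subtype.ext (by simp)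
        rw [this]; exact S.zero_mem
      | tmul m v =>
        have : (⟨mT k M (degT k ^ b) (m ⊗ₜ v), hpow _⟩ : Q) = ((1 : R) ⊗ₜ[k] v) • z m := by
          apply Subtype.ext
          change mT k M (degT k ^ b) (m ⊗ₜ v) =
            ((1 : R) ⊗ₜ[k] v) • mT k M (degT k ^ b) (m ⊗ₜ 1)
          rw [hsmv]
          simp [mul_comm]
        rw [this]; exact S.smul_mem _ (c3 m)
      | add x y hx hy =>
        have : (⟨mT k M (degT k ^ b) (x + y), hpow _⟩ : Q) =
          ⟨mT k M (degT k ^ b) x, hpow _⟩ + ⟨mT k M (degT k ^ b) y, hpow _⟩ :=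
            Subtype.ext (by simp)
        rw [this]; exact S.add_mem hx hy
    refine ⟨(Submodule.fg_def).2 ⟨u '' (SN : Set N) ∪ z '' (SM : Set M), ?_, ?_⟩⟩
    · exact ((Finset.finite_toSet SN).image u).union ((Finset.finite_toSet SM).image z)
    · rw [eq_top_iff]
      intro x _
      obtain ⟨s, hs, y, rfl⟩ := c2 b x
      refine S.add_mem hs ?_
      have : ((1 : R) ⊗ₜ[k] (degT k ^ b)) • y = ⟨mT k M (degT k ^ b) y.1, hpow _⟩ := by
        apply Subtype.ext
        change ((1 : R) ⊗ₜ[k] (degT k ^ b)) • y.1 = _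
        rw [hsmv]
      rw [this]; exact c4 _
  · -- flatness
    let _ := vRestrict k R Q
    have : Module.IsTorsionFree (DegV k) Q := by
      refine ⟨fun v hv x y hxy => Subtype.ext ?_⟩
      have h10 : ((1 : R) ⊗ₜ[k] v) • x.1 = ((1 : R) ⊗ₜ[k] v) • y.1 := congrArg Subtype.val hxy
      rw [hsmv, hsmv] at h10
      exact mT_injective k M v hv.ne_zero h10
    exact inferInstanceAs (Module.Flat (DegV k) Q)
  · -- the special fibre
    let _ := rRestrict k R (Q ⧸ LinearMap.range (tSmul k R Q))
    have hmem : ∀ x : Q, x ∈ LinearMap.range (tSmul k R Q) ↔ PP x = 0 := by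
      intro x
      rw [hPPz]
      rfl
    let F : (Q ⧸ LinearMap.range (tSmul k R Q)) →ₗ[R] N :=
      { toFun := fun x => Quotient.liftOn' x PP (fun a c hac => by
          rw [Submodule.quotientRel_def, hmem, map_sub, sub_eq_zero] at hac
          exact hac)
        map_add' := by
          rintro ⟨x⟩ ⟨y⟩
          exact map_add PP x y
        map_smul' := by
          rintro r ⟨x⟩
          exact hPPr r x }
    have hF : ∀ x : Q, F (Submodule.Quotient.mk x) = PP x := fun x => rfl
    refine ⟨LinearEquiv.ofBijective F ⟨?_, ?_⟩⟩
    · rw [← LinearMap.ker_eq_bot, LinearMap.ker_eq_bot']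
      intro x hx
      obtain ⟨x, rfl⟩ := Submodule.Quotient.mk_surjective _ x
      rw [hF, ← hmem] at hx
      exact (Submodule.Quotient.mk_eq_zero _).2 hx
    · intro n
      obtain ⟨x, rfl⟩ := hPPs n
      exact ⟨_, hF x⟩
  · -- the generic fibre
    let _ := vRestrict k R Q
    have hvdef : ∀ (v : DegV k) (q : Q), ((v • q : Q) : M ⊗[k] DegV k) = mT k M v q.1 :=
      fun v q => hsmv v q.1
    obtain ⟨f, hf, hf'⟩ := loc_backward (k := k) (M := M) (Q := Q)
      ((jj k M).toAddMonoidHom.comp Q.subtype.toAddMonoidHom)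
      (fun v q => by
        change jj k M ((v • q : Q) : M ⊗[k] DegV k) = mK k M _ (jj k M q.1)
        rw [hvdef, jj_mT])
      (fun x => by
        obtain ⟨n, y, hy⟩ := exists_jj k M x
        refine ⟨b + n, ⟨mT k M (degT k ^ b) y, hpow y⟩, ?_⟩
        change _ = jj k M (mT k M (degT k ^ b) y)
        rw [pow_add, mK_mul, hy, jj_mT, map_pow])
      (fun q hq => by
        apply Subtype.ext
        apply jj_injective k M
        rw [show ((0 : Q) : M ⊗[k] DegV k) = 0 from rfl, map_zero]
        exact hq)
    refine ⟨f, hf, fun r x => hf' _ _ (fun q => ?_) x⟩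
    change jj k M ((r ⊗ₜ[k] (1 : DegV k)) • q.1) =
      LinearMap.rTensor (DegK k) (rActK k R M r) (jj k M q.1)
    rw [hsmr, jj_end]

end
/-- `(M^n)^m ≅ M^(mn)`. -/
def powPowEquiv (R : Type) [Ring R] (m n : ℕ) (M : Type) [AddCommGroup M] [Module R M] :
    (Fin m → Fin n → M) ≃ₗ[R] (Fin (m * n) → M) :=
  (LinearEquiv.curry R M (Fin m) (Fin n)).symm.trans
    (LinearEquiv.funCongrLeft R M finProdFinEquiv.symm)

/-- `(M^m)^n ≅ M^(mn)`. -/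
def powPowEquiv' (R : Type) [Ring R] (m n : ℕ) (M : Type) [AddCommGroup M] [Module R M] :
    (Fin n → Fin m → M) ≃ₗ[R] (Fin (m * n) → M) :=
  (powPowEquiv R n m M).trans (LinearEquiv.funCongrLeft R M (finCongr (mul_comm m n)))

/-- `𝒞` is a Kuratowski closure operator on the collection of
finitely generated left `R`-modules. -/
theorem CC_isKuratowskiClosure (k : Type) [Field k] (R : Type) [Ring R] [Algebra k R] :
    CC k R (∅ : Set (FGMod R)) = ∅ ∧
    (∀ X : Set (FGMod R), X ⊆ CC k R X) ∧
    (∀ X Y : Set (FGMod R), CC k R (X ∪ Y) = CC k R X ∪ CC k R Y) ∧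
    (∀ X : Set (FGMod R), CC k R (CC k R X) = CC k R X) := by
  refine ⟨?_, ?_, ?_, ?_⟩
  · ext N
    constructor
    · rintro ⟨M, hM, _⟩
      exact hM.elim
    · intro h
      exact h.elim
  · intro X M hM
    exact ⟨M, hM, 1, one_pos, deg_of_crit k R Crit.refl⟩
  · intro X Y
    ext N
    constructor
    · rintro ⟨M, hM | hM, h⟩
      · exact Or.inl ⟨M, hM, h⟩
      · exact Or.inr ⟨M, hM, h⟩
    · rintro (⟨M, hM, h⟩ | ⟨M, hM, h⟩)
      · exact ⟨M, Or.inl hM, h⟩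
      · exact ⟨M, Or.inr hM, h⟩
  · intro X
    ext P
    constructor
    · rintro ⟨N, ⟨M, hM, n, hn, hMN⟩, m, hm, hNP⟩
      refine ⟨M, hM, m * n, Nat.mul_pos hm hn, deg_of_crit k R ?_⟩
      have h1 := (crit_of_deg k R hMN).pi (Fin m)
      have h2 := (crit_of_deg k R hNP).pi (Fin n)
      have h3 := (h1.congr (powPowEquiv R m n M.carrier) (powPowEquiv R m n N.carrier)).trans
        (h2.congr (powPowEquiv' R m n N.carrier) (powPowEquiv' R m n P.carrier))
      exact h3
    · intro hP
      exact ⟨P, hP, 1, one_pos, deg_of_crit k R Crit.refl⟩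
end
end

section
/- Let k be a field, R an associative unital k-algebra, and M a finitely generated left R-module. Then 𝒞(M) is a nonempty irreducible closed set; precisely: 𝒞(𝒞(M)) = 𝒞(M), M ∈ 𝒞(M), and whenever 𝒞(M) = 𝒳 ∪ 𝒴 for sets 𝒳, 𝒴 of finitely generated left R-modules with 𝒞(𝒳) = 𝒳 and 𝒞(𝒴) = 𝒴, one has 𝒞(M) = 𝒳 or 𝒞(M) = 𝒴. -/
open Polynomial TensorProduct

noncomputable section

/-! ### Lattices in `M[[t]]` -/

section Lattice

/-- multiplication by `t` on `M[[t]]`. -/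
def shiftT (M : Type) [AddCommGroup M] (x : ℕ → M) : ℕ → M
  | 0 => 0
  | (i+1) => x i

/-- Degeneration in terms of lattices in `M[[t]]`. -/
def LDeg (R : Type) [Ring R] (M N : Type) [AddCommGroup M] [Module R M] [AddCommGroup N]
    [Module R N] : Prop :=
  ∃ (S : Submodule R (ℕ → M)) (n : ℕ) (φ : S →ₗ[R] N),
    (∀ x ∈ S, shiftT M x ∈ S) ∧ (∀ x : ℕ → M, (∀ i < n, x i = 0) → x ∈ S) ∧
    Function.Surjective φ ∧ (∀ x : S, φ x = 0 ↔ ∃ y ∈ S, x.1 = shiftT M y)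

variable {R : Type} [Ring R]

theorem LDeg.refl (M : Type) [AddCommGroup M] [Module R M] : LDeg R M M := by
  refine ⟨⊤, 0, (LinearMap.proj 0) ∘ₗ (Submodule.subtype _), ?_, ?_, ?_, ?_⟩
  · simp
  · simp
  · intro m
    exact ⟨⟨fun _ => m, trivial⟩, rfl⟩
  · rintro ⟨x, hx⟩
    constructor
    · intro h
      refine ⟨fun i => x (i+1), trivial, ?_⟩
      funext i
      cases i with
      | zero => exact h
      | succ i => rfl
    · rintro ⟨y, -, h⟩
      change x 0 = 0
      change x = _ at h
      rw [h]; rfl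

theorem LDeg.pow {M N M' N' : Type} [AddCommGroup M] [Module R M] [AddCommGroup N] [Module R N]
    [AddCommGroup M'] [Module R M'] [AddCommGroup N'] [Module R N'] {ι : Type}
    (e : M' ≃ₗ[R] (ι → M)) (e' : N' ≃ₗ[R] (ι → N)) (h : LDeg R M N) : LDeg R M' N' := by
  obtain ⟨S, n, φ, hT, hn, hs, hk⟩ := h
  let c (j : ι) : (ℕ → M') →ₗ[R] (ℕ → M) :=
    LinearMap.pi (fun i => LinearMap.proj j ∘ₗ e.toLinearMap ∘ₗ LinearMap.proj i)
  have hc (j x i) : c j x i = e (x i) j := rfl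
  have hcT (j x) : c j (shiftT M' x) = shiftT M (c j x) := by
    funext i; cases i <;> simp [hc, shiftT]
  let S' : Submodule R (ℕ → M') := ⨅ j, S.comap (c j)
  have hS' (x) : x ∈ S' ↔ ∀ j, c j x ∈ S := by simp [S']
  let cc (j : ι) : S' →ₗ[R] S := (c j).restrict (fun x hx => (hS' x).1 hx j)
  refine ⟨S', n, e'.symm.toLinearMap ∘ₗ LinearMap.pi (fun j => φ ∘ₗ cc j), ?_, ?_, ?_, ?_⟩
  · intro x hx
    rw [hS'] at *
    intro j
    rw [hcT]
    exact hT _ (hx j)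
  · intro x hx
    rw [hS']
    intro j
    apply hn
    intro i hi
    simp [hc, hx i hi]
  · intro y
    choose z hz using fun j => hs (e' y j)
    have hx : (fun i => e.symm (fun j => (z j).1 i)) ∈ S' := by
      rw [hS']; intro j
      convert (z j).2 using 1
      funext i
      simp [hc]
    refine ⟨⟨_, hx⟩, ?_⟩
    simp only [LinearMap.comp_apply, LinearEquiv.coe_coe]
    rw [LinearEquiv.symm_apply_eq]
    funext j
    rw [← hz j]
    simp only [LinearMap.pi_apply, LinearMap.comp_apply]
    congr 1
    ext i
    change e (e.symm _) j = _
    simp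
  · rintro ⟨x, hx⟩
    simp only [LinearMap.comp_apply, LinearEquiv.coe_coe]
    rw [LinearEquiv.symm_apply_eq, map_zero, funext_iff]
    simp only [LinearMap.pi_apply, LinearMap.comp_apply, Pi.zero_apply, hk]
    constructor
    · intro h
      choose y hy hxy using h
      refine ⟨fun i => e.symm (fun j => y j i), ?_, ?_⟩
      · rw [hS']; intro j
        convert hy j using 1
        funext i
        simp [hc]
      · funext i
        apply e.injective
        funext j
        have := congrFun (hxy j) i
        change e (x i) j = _ at this
        rw [this]
        cases i <;> simp [shiftT]
    · rintro ⟨y, hy, h⟩ j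
      refine ⟨c j y, (hS' _).1 hy j, ?_⟩
      rw [← hcT, ← h]
      rfl

theorem LDeg.trans {M N L : Type} [AddCommGroup M] [Module R M] [AddCommGroup N] [Module R N]
    [AddCommGroup L] [Module R L] (h₁ : LDeg R M N) (h₂ : LDeg R N L) : LDeg R M L := by
  obtain ⟨S₁, a, φ₁, hT₁, ha, hs₁, hk₁⟩ := h₁
  obtain ⟨S₂, b, φ₂, hT₂, hb, hs₂, hk₂⟩ := h₂
  let c (j : ℕ) : (ℕ → M) →ₗ[R] (ℕ → M) :=
    LinearMap.pi (fun i => LinearMap.proj ((b+1) * i + j))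
  have hc (j x i) : c j x i = x ((b+1) * i + j) := rfl
  have hc0 (x) : c 0 (shiftT M x) = shiftT M (c b x) := by
    funext i
    cases i with
    | zero => rfl
    | succ i =>
      rw [hc]
      change shiftT M x (((b+1) * i + b) + 1) = x ((b+1)*i + b)
      rfl
  have hcs (j x) : c (j+1) (shiftT M x) = c j x := by
    funext i
    rfl
  have hcinj (x y : ℕ → M) (h : ∀ j ≤ b, c j x = c j y) : x = y := by
    funext m
    have := congrFun (h (m % (b+1)) (Nat.le_of_lt_succ (Nat.mod_lt m (Nat.succ_pos b)))) (m / (b+1))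
    simpa only [hc, Nat.div_add_mod] using this
  have hcsurj (X : ℕ → ℕ → M) : ∃ x, ∀ j ≤ b, c j x = X j := by
    refine ⟨fun m => X (m % (b+1)) (m / (b+1)), ?_⟩
    intro j hj
    funext i
    rw [hc]
    have h1 : ((b+1) * i + j) % (b+1) = j := by
      rw [Nat.mul_add_mod]; exact Nat.mod_eq_of_lt (by omega)
    have h2 : ((b+1) * i + j) / (b+1) = i := by
      rw [Nat.mul_add_div (Nat.succ_pos b), Nat.div_eq_of_lt (by omega)]; rfl
    simp only [h1, h2]
  let S1 : Submodule R (ℕ → M) := ⨅ j, ⨅ (_ : j ≤ b), S₁.comap (c j)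
  have hS1 (x) : x ∈ S1 ↔ ∀ j ≤ b, c j x ∈ S₁ := by simp [S1]
  let cc (j : ℕ) (hj : j ≤ b) : S1 →ₗ[R] S₁ := (c j).restrict (fun x hx => (hS1 x).1 hx j hj)
  let ψ : S1 →ₗ[R] (ℕ → N) :=
    LinearMap.pi (fun j => if hj : j ≤ b then φ₁ ∘ₗ cc j hj else 0)
  have hψ (x : S1) (j) (hj : j ≤ b) : ψ x j = φ₁ ⟨c j x, (hS1 x).1 x.2 j hj⟩ := by
    simp only [ψ, LinearMap.pi_apply, dif_pos hj]; rfl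
  let S : Submodule R (ℕ → M) := (S₂.comap ψ).map S1.subtype
  have hS (x) : x ∈ S ↔ ∃ h : x ∈ S1, ψ ⟨x, h⟩ ∈ S₂ := by
    simp [S]
  have hTS1 (x) (hx : x ∈ S1) : shiftT M x ∈ S1 := by
    rw [hS1] at *
    intro j hj
    cases j with
    | zero => rw [hc0]; exact hT₁ _ (hx b le_rfl)
    | succ j => rw [hcs]; exact hx j (by omega)
  have hψT (x : S1) : ∀ j ≤ b, ψ ⟨_, hTS1 x x.2⟩ j = shiftT N (ψ x) j := by
    intro j hj
    rw [hψ _ _ hj]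
    cases j with
    | zero =>
      change _ = 0
      rw [hk₁]
      exact ⟨_, (hS1 x).1 x.2 b le_rfl, hc0 _⟩
    | succ j =>
      change _ = ψ x j
      rw [hψ x j (by omega)]
      rfl
  -- elements agreeing up to `b` are congruent mod `S₂`, and mod `ker φ₂`
  have hcongr (x y : ℕ → N) (h : ∀ j < b, x j = y j) (hy : y ∈ S₂) : x ∈ S₂ := by
    have : x - y ∈ S₂ := hb _ (fun i hi => by simp [h i hi])
    simpa using S₂.add_mem this hy
  have hcongr' (x y : S₂) (h : ∀ j ≤ b, x.1 j = y.1 j) : φ₂ x = φ₂ y := by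
    rw [← sub_eq_zero, ← map_sub, hk₂]
    refine ⟨fun i => x.1 (i+1) - y.1 (i+1), hb _ (fun i hi => ?_), ?_⟩
    · simp [h (i+1) (by omega)]
    · funext i
      cases i with
      | zero => simp [shiftT, h 0]
      | succ i => simp [shiftT]
  let φS : S →ₗ[R] L :=
    { toFun := fun x => φ₂ ⟨ψ ⟨x.1, ((hS _).1 x.2).1⟩, ((hS _).1 x.2).2⟩
      map_add' := fun x y => by
        rw [← map_add]; congr 1; ext1
        simp only [Submodule.coe_add, ← map_add]; rfl
      map_smul' := fun r x => by
        rw [← map_smul]; congr 1; ext1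
        simp only [RingHom.id_apply, Submodule.coe_smul, ← map_smul]; rfl }
  have hφS (x) (h1 : x ∈ S1) (h2 : ψ ⟨x, h1⟩ ∈ S₂) :
      φS ⟨x, (hS _).2 ⟨h1, h2⟩⟩ = φ₂ ⟨ψ ⟨x, h1⟩, h2⟩ := rfl
  have hTS (x) (hx : x ∈ S) : shiftT M x ∈ S := by
    obtain ⟨h1, h2⟩ := (hS x).1 hx
    refine (hS _).2 ⟨hTS1 _ h1, ?_⟩
    exact hcongr _ _ (fun j hj => hψT ⟨x, h1⟩ j hj.le) (hT₂ _ h2)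
  refine ⟨S, (b+1)*(a+1) + b, φS, hTS, ?_, ?_, ?_⟩
  · intro x hx
    have hx' : ∀ j ≤ b, ∀ i ≤ a, c j x i = 0 := by
      intro j hj i hi
      by_cases h : (b+1)*i + j < (b+1)*(a+1) + b
      · exact hx _ h
      · exfalso; apply h; nlinarith
    have h1 : x ∈ S1 := (hS1 x).2 fun j hj => ha _ fun i hi => hx' j hj i hi.le
    refine (hS _).2 ⟨h1, ?_⟩
    have h0 : ∀ j < b, ψ ⟨x, h1⟩ j = (0 : ℕ → N) j := by
      intro j hj
      rw [hψ _ _ hj.le, Pi.zero_apply, hk₁]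
      refine ⟨fun i => c j x (i+1), ha _ fun i hi => hx' j hj.le _ hi, ?_⟩
      funext i
      cases i with
      | zero => exact hx' j hj.le 0 (by omega)
      | succ i => rfl
    exact hcongr _ _ h0 S₂.zero_mem
  · intro l
    obtain ⟨y, rfl⟩ := hs₂ l
    choose z hz using fun j => hs₁ (y.1 j)
    obtain ⟨x, hx⟩ := hcsurj fun j => (z j).1
    have h1 : x ∈ S1 := (hS1 x).2 fun j hj => by rw [hx j hj]; exact (z j).2
    have h0 : ∀ j ≤ b, ψ ⟨x, h1⟩ j = y.1 j := by
      intro j hj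
      rw [hψ _ _ hj, ← hz j]
      congr 1
      ext1
      exact hx j hj
    have h2 := hcongr _ _ (fun j hj => h0 j hj.le) y.2
    refine ⟨⟨x, (hS _).2 ⟨h1, h2⟩⟩, ?_⟩
    rw [hφS x h1 h2]
    exact hcongr' _ _ h0
  · rintro ⟨x, hxS⟩
    obtain ⟨h1, h2⟩ := (hS x).1 hxS
    rw [hφS x h1 h2]
    constructor
    · intro h
      obtain ⟨y, hy, hxy⟩ := (hk₂ _).1 h
      change ψ ⟨x, h1⟩ = shiftT N y at hxy
      have h0 := congrFun hxy 0
      rw [hψ _ _ (Nat.zero_le _)] at h0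
      obtain ⟨z, hz, hxz⟩ := (hk₁ _).1 h0
      change c 0 x = shiftT M z at hxz
      obtain ⟨x', hx'⟩ := hcsurj fun j => if j = b then z else c (j+1) x
      have hx'b : c b x' = z := by simpa using hx' b le_rfl
      have hx's (j) (hj : j < b) : c j x' = c (j+1) x := by
        simpa [hj.ne] using hx' j hj.le
      have h1' : x' ∈ S1 := by
        rw [hS1]
        intro j hj
        rcases hj.lt_or_eq with hj | rfl
        · rw [hx's j hj]; exact (hS1 x).1 h1 _ hj
        · rwa [hx'b]
      refine ⟨x', (hS _).2 ⟨h1', ?_⟩, ?_⟩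
      · refine hcongr _ y (fun j hj => ?_) hy
        have := congrFun hxy (j+1)
        change _ = y j at this
        rw [← this, hψ _ _ hj.le, hψ _ _ hj]
        congr 1
        ext1
        exact hx's j hj
      · apply hcinj
        intro j hj
        cases j with
        | zero => rw [hc0, hx'b]; exact hxz
        | succ j => rw [hcs, hx's j hj]
    · rintro ⟨y, hy, h⟩
      change x = _ at h
      subst h
      obtain ⟨h1', h2'⟩ := (hS y).1 hy
      have := hcongr' ⟨_, h2⟩ ⟨_, hT₂ _ h2'⟩ (fun j hj => hψT ⟨y, h1'⟩ j hj)
      rw [this, hk₂]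
      exact ⟨_, h2', rfl⟩

end Lattice

/-! ### The discrete valuation ring `V` -/

section VRing

variable (k : Type) [Field k]

instance degV_isLoc : IsLocalization (tIdeal k).primeCompl (DegV k) :=
  inferInstanceAs (IsLocalization (tIdeal k).primeCompl (Localization.AtPrime (tIdeal k)))

instance degK_isLoc : IsLocalization (Submonoid.powers (degT k)) (DegK k) :=
  inferInstanceAs (IsLocalization (Submonoid.powers (degT k))
    (Localization (Submonoid.powers (degT k))))

instance degVK_tower : IsScalarTower k (DegV k) (DegK k) :=
  inferInstanceAs (IsScalarTower k (DegV k) (Localization (Submonoid.powers (degT k))))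

instance degV_isDomain : IsDomain (DegV k) :=
  IsLocalization.isDomain_of_le_nonZeroDivisors (M := (tIdeal k).primeCompl) _
    (Ideal.primeCompl_le_nonZeroDivisors _)

instance degV_ded : IsDedekindDomain (DegV k) :=
  IsLocalization.isDedekindDomain k[X] (Ideal.primeCompl_le_nonZeroDivisors (tIdeal k)) _

theorem powers_le : Submonoid.powers (degT k) ≤ nonZeroDivisors (DegV k) :=
  powers_le_nonZeroDivisors_of_noZeroDivisors (degT_ne_zero k)

theorem degVK_inj : Function.Injective (algebraMap (DegV k) (DegK k)) :=
  IsLocalization.injective _ (powers_le k)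

theorem mem_tIdeal (p : k[X]) : p ∈ tIdeal k ↔ p.eval 0 = 0 := by
  rw [tIdeal, Ideal.mem_span_singleton, Polynomial.X_dvd_iff, Polynomial.coeff_zero_eq_eval_zero]

/-- evaluation at `t = 0`. -/
def ev : DegV k →+* k :=
  IsLocalization.lift (M := (tIdeal k).primeCompl) (g := Polynomial.evalRingHom (0 : k)) (by
    rintro ⟨p, hp⟩
    rw [isUnit_iff_ne_zero]
    intro h
    exact hp ((mem_tIdeal k p).2 h))

theorem ev_poly (p : k[X]) : ev k (algebraMap _ _ p) = p.eval 0 :=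
  IsLocalization.lift_eq _ _

theorem ev_algebraMap (c : k) : ev k (algebraMap k _ c) = c := by
  rw [IsScalarTower.algebraMap_apply k k[X] (DegV k), ev_poly]
  simp

theorem ev_t : ev k (degT k) = 0 := by
  rw [degT, ev_poly]; simp

theorem ev_eq_zero (v : DegV k) (h : ev k v = 0) : ∃ w, v = degT k * w := by
  obtain ⟨p, q, rfl⟩ := IsLocalization.exists_mk'_eq (tIdeal k).primeCompl v
  have h1 : ev k (algebraMap _ _ p) = 0 := by
    rw [← IsLocalization.mk'_spec (DegV k) p q, map_mul, h, zero_mul]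
  rw [ev_poly, ← Polynomial.coeff_zero_eq_eval_zero, ← Polynomial.X_dvd_iff] at h1
  obtain ⟨p', rfl⟩ := h1
  exact ⟨IsLocalization.mk' _ p' q, (IsLocalization.mul_mk'_eq_mk'_of_mul _ _ _).symm⟩

theorem exists_div (v : DegV k) : ∃ w, v = algebraMap k _ (ev k v) + degT k * w := by
  obtain ⟨w, hw⟩ := ev_eq_zero k (v - algebraMap k _ (ev k v)) (by
    rw [map_sub, ev_algebraMap, sub_self])
  exact ⟨w, by rw [← hw]; ring⟩

/-- `v ↦ (v - v(0))/t`. -/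
def dv (v : DegV k) : DegV k := (exists_div k v).choose

theorem dv_spec (v : DegV k) : v = algebraMap k _ (ev k v) + degT k * dv k v :=
  (exists_div k v).choose_spec

theorem dv_unique {v w : DegV k} {c : k} (h : v = algebraMap k _ c + degT k * w) :
    dv k v = w := by
  have h1 : ev k v = c := by rw [h, map_add, ev_algebraMap, map_mul, ev_t, zero_mul, add_zero]
  have h2 := dv_spec k v
  rw [h1] at h2
  have h3 := h.symm.trans h2
  exact (mul_left_cancel₀ (degT_ne_zero k) (add_left_cancel h3)).symm

def evL : DegV k →ₗ[k] k where
  toFun := ev k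
  map_add' := map_add _
  map_smul' c v := by
    rw [Algebra.smul_def, map_mul, ev_algebraMap]; rfl

def dvL : DegV k →ₗ[k] DegV k where
  toFun := dv k
  map_add' x y := by
    apply dv_unique k (c := ev k x + ev k y)
    conv_lhs => rw [dv_spec k x, dv_spec k y]
    rw [map_add]; ring
  map_smul' c x := by
    apply dv_unique k (c := c * ev k x)
    conv_lhs => rw [dv_spec k x]
    simp only [Algebra.smul_def, map_mul, RingHom.id_apply]; ring

theorem evL_mul_t (v : DegV k) : evL k (degT k * v) = 0 := by
  change ev k _ = 0
  rw [map_mul, ev_t, zero_mul]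

theorem dvL_mul_t (v : DegV k) : dvL k (degT k * v) = v := by
  apply dv_unique k (c := 0)
  simp

end VRing

section Act

variable (k : Type) [Field k] (R : Type) [Ring R] [Algebra k R]
  (M : Type) [AddCommGroup M] [Module k M] [Module R M] [IsScalarTower k R M]
  (B : Type) [CommRing B] [Algebra k B] [Algebra (DegV k) B] [IsScalarTower k (DegV k) B]

def actHom : R ⊗[k] DegV k →ₐ[k] Module.End k (M ⊗[k] B) :=
  (Module.endTensorEndAlgHom (R := k) (S := k) (A := k) (M := M) (N := B)).comp
    (Algebra.TensorProduct.map (Algebra.lsmul k k M) 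
      ((Algebra.lmul k B).comp (IsScalarTower.toAlgHom k (DegV k) B)))

@[reducible] def actModule : Module (R ⊗[k] DegV k) (M ⊗[k] B) :=
  Module.compHom _ (actHom k R M B).toRingHom

attribute [local instance] actModule

theorem act_tmul (r : R) (v : DegV k) (m : M) (b : B) :
    (r ⊗ₜ[k] v) • (m ⊗ₜ[k] b) = (r • m) ⊗ₜ[k] (algebraMap _ _ v * b) := rfl

theorem act_eq_rTensor (r : R) (x : M ⊗[k] B) :
    (r ⊗ₜ[k] (1 : DegV k)) • x = LinearMap.rTensor B (Algebra.lsmul k k M r) x := by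
  induction x with
  | zero => simp
  | tmul m b => rw [act_tmul]; simp
  | add x y hx hy => rw [smul_add, map_add, hx, hy]

theorem act_eq_lTensor (v : DegV k) (x : M ⊗[k] B) :
    ((1 : R) ⊗ₜ[k] v) • x = LinearMap.lTensor M (LinearMap.mulLeft k (algebraMap _ B v)) x := by
  induction x with
  | zero => simp
  | tmul m b => rw [act_tmul]; simp
  | add x y hx hy => rw [smul_add, map_add, hx, hy]

/-- the element `1 ⊗ t`. -/
def tt : R ⊗[k] DegV k := (1 : R) ⊗ₜ degT k

theorem tt_pow (n : ℕ) : tt k R ^ n = (1 : R) ⊗ₜ (degT k ^ n) := by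
  rw [tt, Algebra.TensorProduct.tmul_pow, one_pow]

theorem tt_comm (x : R ⊗[k] DegV k) : x * tt k R = tt k R * x := degT_central k R x

theorem tt_pow_comm (n : ℕ) (x : R ⊗[k] DegV k) : x * tt k R ^ n = tt k R ^ n * x :=
  (Commute.pow_right (tt_comm k R x) n)

/-- `M ⊗ V → M ⊗ K`. -/
def hVK : M ⊗[k] DegV k →ₗ[R ⊗[k] DegV k] M ⊗[k] DegK k where
  toFun := LinearMap.lTensor M (IsScalarTower.toAlgHom k (DegV k) (DegK k)).toLinearMap
  map_add' := map_add _
  map_smul' a x := by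
    simp only [RingHom.id_apply]
    induction x with
    | zero => simp
    | add x y hx hy => simp only [smul_add, map_add, hx, hy]
    | tmul m w =>
      induction a with
      | zero => simp
      | add x y hx hy => simp only [add_smul, map_add, hx, hy]
      | tmul r v => 
        simp only [act_tmul, LinearMap.lTensor_tmul]
        simp

theorem hVK_tmul (m : M) (v : DegV k) : hVK k R M (m ⊗ₜ v) = m ⊗ₜ algebraMap _ _ v := rfl

theorem hVK_inj : Function.Injective (hVK k R M) :=
  Module.Flat.lTensor_preserves_injective_linearMap _ (degVK_inj k)

theorem smul_inj (v : DegV k) (hv : v ≠ 0) (x : M ⊗[k] DegK k)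
    (h : ((1 : R) ⊗ₜ[k] v) • x = 0) : x = 0 := by
  rw [act_eq_lTensor] at h
  have hd : IsDomain (DegK k) := IsLocalization.isDomain_of_le_nonZeroDivisors
    (M := Submonoid.powers (degT k)) _ (powers_le k)
  have : Function.Injective (LinearMap.mulLeft k (algebraMap _ (DegK k) v)) := by
    intro a b hab
    refine mul_left_cancel₀ ?_ hab
    rw [Ne, map_eq_zero_iff _ (degVK_inj k)]
    exact hv
  exact Module.Flat.lTensor_preserves_injective_linearMap (M := M) _ this (h.trans (map_zero _).symm)

theorem tt_pow_inj (n : ℕ) {x y : M ⊗[k] DegK k}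
    (h : tt k R ^ n • x = tt k R ^ n • y) : x = y := by
  rw [← sub_eq_zero] at h ⊢
  rw [← smul_sub, tt_pow] at h
  exact smul_inj k R M _ (pow_ne_zero _ (degT_ne_zero k)) _ h

theorem tt_pow_surj (n : ℕ) (x : M ⊗[k] DegK k) : ∃ y, tt k R ^ n • y = x := by
  induction x with
  | zero => exact ⟨0, smul_zero _⟩
  | add x y hx hy =>
    obtain ⟨x', rfl⟩ := hx
    obtain ⟨y', rfl⟩ := hy
    exact ⟨x' + y', smul_add _ _ _⟩
  | tmul m c =>
    refine ⟨m ⊗ₜ (IsLocalization.mk' _ (1 : DegV k)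
      (⟨degT k ^ n, n, rfl⟩ : Submonoid.powers (degT k)) * c), ?_⟩
    rw [tt_pow, act_tmul, one_smul, ← mul_assoc]
    rw [IsLocalization.mk'_spec' (DegK k) (1 : DegV k) (⟨degT k ^ n, n, rfl⟩ : Submonoid.powers (degT k))]
    simp

theorem exists_hVK (x : M ⊗[k] DegK k) : ∃ j y, tt k R ^ j • x = hVK k R M y := by
  induction x with
  | zero => exact ⟨0, 0, by simp⟩
  | add x y hx hy =>
    obtain ⟨i, x', hx⟩ := hx
    obtain ⟨j, y', hy⟩ := hy
    refine ⟨i + j, tt k R ^ j • x' + tt k R ^ i • y', ?_⟩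
    rw [map_add, map_smul, map_smul, ← hx, ← hy, ← mul_smul, ← mul_smul, ← pow_add, ← pow_add,
      smul_add, add_comm j i]
  | tmul m c =>
    obtain ⟨v, ⟨_, n, rfl⟩, rfl⟩ := IsLocalization.exists_mk'_eq (Submonoid.powers (degT k)) c
    refine ⟨n, m ⊗ₜ v, ?_⟩
    rw [tt_pow, act_tmul, one_smul, hVK_tmul]
    congr 1
    exact IsLocalization.mk'_spec' (DegK k) v _

/-- coefficients `M ⊗ V → M[[t]]`. -/
def pc : M ⊗[k] DegV k →ₗ[k] (ℕ → M) :=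
  LinearMap.pi fun i => (TensorProduct.rid k M).toLinearMap ∘ₗ
    LinearMap.lTensor M (evL k ∘ₗ (dvL k) ^ i)

theorem pc_tmul (m : M) (v : DegV k) (i : ℕ) :
    pc k M (m ⊗ₜ v) i = evL k (((dvL k) ^ i) v) • m := by
  simp [pc]

theorem pc_r (r : R) (x : M ⊗[k] DegV k) : 
    pc k M ((r ⊗ₜ[k] (1 : DegV k)) • x) = r • pc k M x := by
  induction x with
  | zero => simp
  | add x y hx hy => simp only [smul_add, map_add, hx, hy]
  | tmul m v =>
    funext i
    rw [act_tmul, Pi.smul_apply, pc_tmul, pc_tmul]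
    simp only [map_one, one_mul]
    rw [← algebraMap_smul R, ← algebraMap_smul R (evL k _), ← mul_smul, ← mul_smul,
      Algebra.commutes]

theorem pc_t (x : M ⊗[k] DegV k) : pc k M (tt k R • x) = shiftT M (pc k M x) := by
  induction x with
  | zero => 
    simp only [smul_zero, map_zero]
    funext i; cases i <;> rfl
  | add x y hx hy =>
    simp only [smul_add, map_add, hx, hy]
    funext i; cases i <;> simp [shiftT]
  | tmul m v =>
    funext i
    rw [tt, act_tmul, pc_tmul, one_smul]
    simp only [Algebra.algebraMap_self, RingHom.id_apply]
    cases i with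
    | zero => simp [shiftT, evL_mul_t]
    | succ i => 
      simp only [shiftT, pc_tmul]
      rw [pow_succ, Module.End.mul_apply, dvL_mul_t]

theorem pc_decomp (x : M ⊗[k] DegV k) : 
    x = pc k M x 0 ⊗ₜ 1 + tt k R • LinearMap.lTensor M (dvL k) x := by
  induction x with
  | zero => simp
  | add x y hx hy =>
    conv_lhs => rw [hx, hy]
    simp only [map_add, smul_add, Pi.add_apply, TensorProduct.add_tmul]
    abel
  | tmul m v =>
    rw [pc_tmul, LinearMap.lTensor_tmul, tt, act_tmul, one_smul, TensorProduct.smul_tmul,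
      ← TensorProduct.tmul_add]
    congr 1
    rw [← Algebra.algebraMap_eq_smul_one]
    exact dv_spec k v

theorem pc_div (n : ℕ) (x : M ⊗[k] DegV k) (h : ∀ i < n, pc k M x i = 0) :
    ∃ y, x = tt k R ^ n • y := by
  induction n generalizing x with
  | zero => exact ⟨x, by simp⟩
  | succ n ih =>
    have h0 := pc_decomp k R M x
    rw [h 0 (by omega), TensorProduct.zero_tmul, zero_add] at h0
    obtain ⟨y, hy⟩ := ih (LinearMap.lTensor M (dvL k) x) (fun i hi => by
      have := h (i+1) (by omega)
      rw [h0, pc_t] at this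
      exact this)
    refine ⟨y, ?_⟩
    rw [h0, hy, pow_succ', mul_smul]

theorem pc_tmul_one (m : M) : pc k M (m ⊗ₜ 1) 0 = m := by
  rw [pc_tmul]
  have : evL k (1 : DegV k) = 1 := map_one (ev k)
  simp [this]

theorem pc_tmul_one_succ (m : M) (i : ℕ) : pc k M (m ⊗ₜ 1) (i+1) = 0 := by
  rw [pc_tmul, pow_succ, Module.End.mul_apply]
  have : dvL k (1 : DegV k) = 0 := by
    apply dv_unique k (c := 1)
    simp
  simp [this]

theorem pc_approx (n : ℕ) (x : ℕ → M) : ∃ y, ∀ i < n, pc k M y i = x i := by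
  induction n generalizing x with
  | zero => exact ⟨0, by simp⟩
  | succ n ih =>
    obtain ⟨y, hy⟩ := ih (fun i => x (i+1))
    refine ⟨x 0 ⊗ₜ 1 + tt k k • y, fun i hi => ?_⟩
    rw [map_add, pc_t, Pi.add_apply]
    cases i with
    | zero => simp [pc_tmul_one, shiftT]
    | succ i => simp [pc_tmul_one_succ, shiftT, hy i (by omega)]

theorem pc_stable (S : Submodule R (ℕ → M)) (hT : ∀ x ∈ S, shiftT M x ∈ S) (n : ℕ)
    (hn : ∀ x : ℕ → M, (∀ i < n, x i = 0) → x ∈ S)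
    (a : R ⊗[k] DegV k) (y : M ⊗[k] DegV k) (hy : pc k M y ∈ S) : pc k M (a • y) ∈ S := by
  have hz : ∀ j (z : M ⊗[k] DegV k), ∀ i < j, pc k M (tt k R ^ j • z) i = 0 := by
    intro j
    induction j with
    | zero => simp
    | succ j ih =>
      intro z i hi
      rw [pow_succ', mul_smul, pc_t]
      cases i with
      | zero => rfl
      | succ i => exact ih z i (by omega)
  have key : ∀ d j, j + d = n → ∀ (v : DegV k) (y : M ⊗[k] DegV k), pc k M y ∈ S →
      pc k M (((1 : R) ⊗ₜ[k] v) • tt k R ^ j • y) ∈ S := by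
    intro d
    induction d with
    | zero =>
      intro j hj v y _
      apply hn
      rw [← mul_smul, tt_pow_comm, mul_smul]
      exact fun i hi => hz _ _ i (by omega)
    | succ d ih =>
      intro j hj v y hy
      have h1 : (1 : R) ⊗ₜ[k] v = (algebraMap k R (ev k v)) ⊗ₜ 1 + ((1 : R) ⊗ₜ dv k v) * tt k R := by
        conv_lhs => rw [dv_spec k v]
        rw [TensorProduct.tmul_add, Algebra.algebraMap_eq_smul_one, Algebra.algebraMap_eq_smul_one,
          TensorProduct.smul_tmul, tt, Algebra.TensorProduct.tmul_mul_tmul, mul_one,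
          mul_comm (dv k v)]
      rw [h1, add_smul, map_add, pc_r, mul_smul, ← mul_smul (tt k R), ← pow_succ']
      refine S.add_mem (S.smul_mem _ ?_) (ih _ (by omega) _ _ hy)
      have : ∀ j, pc k M (tt k R ^ j • y) ∈ S := by
        intro j
        induction j with
        | zero => simpa using hy
        | succ j ih => rw [pow_succ', mul_smul, pc_t]; exact hT _ ih
      exact this j
  induction a with
  | zero => simp
  | add a b ha hb => rw [add_smul, map_add]; exact S.add_mem ha hb
  | tmul r v =>
    have : r ⊗ₜ[k] v = (r ⊗ₜ (1 : DegV k)) * ((1 : R) ⊗ₜ v) := by simp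
    rw [this, mul_smul, pc_r]
    apply S.smul_mem
    simpa using key n 0 (by simp) v y hy

end Act

section Interface

attribute [local instance] actModule

/-- Intermediate form of degeneration. -/
def DegI (k : Type) [Field k] (R : Type) [Ring R] [Algebra k R]
    (M : Type) [AddCommGroup M] [Module k M] [Module R M] [IsScalarTower k R M]
    (N : Type) [AddCommGroup N] [Module R N] : Prop :=
  ∃ (Q : Type) (_ : AddCommGroup Q) (_ : Module (R ⊗[k] DegV k) Q) (μ : Q →+ N)
    (g : Q →ₗ[R ⊗[k] DegV k] M ⊗[k] DegK k),
    Module.Finite (R ⊗[k] DegV k) Q ∧ Function.Surjective μ ∧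
    (∀ (r : R) q, μ ((r ⊗ₜ[k] (1 : DegV k)) • q) = r • μ q) ∧
    (∀ q, μ q = 0 ↔ ∃ q', q = tt k R • q') ∧
    Function.Injective g ∧ (∀ x, ∃ j q, tt k R ^ j • x = g q)

theorem fin_bound {A P X : Type} [Ring A] [AddCommGroup P] [Module A P] [AddCommGroup X]
    [Module A X] [Module.Finite A P] (τ : A) (hτ : ∀ x, x * τ = τ * x) (u : P →ₗ[A] X)
    (Y : Submodule A X) (h : ∀ p, ∃ j : ℕ, τ ^ j • u p ∈ Y) : ∃ a : ℕ, ∀ p, τ ^ a • u p ∈ Y := by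
  obtain ⟨s, hs⟩ := Module.Finite.fg_top (R := A) (M := P)
  choose j hj using h
  refine ⟨s.sup j, fun p => ?_⟩
  have hp : p ∈ Submodule.span A (s : Set P) := hs ▸ Submodule.mem_top
  induction hp using Submodule.span_induction with
  | mem x hx =>
    obtain ⟨c, hc⟩ := Nat.exists_eq_add_of_le (Finset.le_sup (f := j) hx)
    rw [hc, add_comm, pow_add, mul_smul]
    exact Y.smul_mem _ (hj x)
  | zero => simp
  | add x y _ _ hx hy => rw [map_add, smul_add]; exact Y.add_mem hx hy
  | smul c x _ hx =>
    rw [map_smul, ← mul_smul, ← (Commute.pow_right (hτ c) _ : c * _ = _), mul_smul]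
    exact Y.smul_mem _ hx

variable (k : Type) [Field k] (R : Type) [Ring R] [Algebra k R]
  (M : Type) [AddCommGroup M] [Module k M] [Module R M] [IsScalarTower k R M]
  (N : Type) [AddCommGroup N] [Module R N]

theorem span_tmul_one (s : Set M) (hs : Submodule.span R s = ⊤) :
    Submodule.span (R ⊗[k] DegV k) ((fun m => m ⊗ₜ[k] (1 : DegV k)) '' s) = ⊤ := by
  rw [eq_top_iff]
  rintro x -
  have h1 : ∀ m : M, m ⊗ₜ[k] (1 : DegV k) ∈
      Submodule.span (R ⊗[k] DegV k) ((fun m => m ⊗ₜ[k] (1 : DegV k)) '' s) := by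
    intro m
    have hm : m ∈ Submodule.span R s := hs ▸ Submodule.mem_top
    induction hm using Submodule.span_induction with
    | mem x hx => exact Submodule.subset_span ⟨x, hx, rfl⟩
    | zero => simp
    | add x y _ _ hx hy => rw [TensorProduct.add_tmul]; exact Submodule.add_mem _ hx hy
    | smul c x _ hx =>
      have : (c • x) ⊗ₜ[k] (1 : DegV k) = (c ⊗ₜ[k] (1 : DegV k)) • (x ⊗ₜ[k] (1 : DegV k)) := by
        rw [act_tmul]; simp
      rw [this]
      exact Submodule.smul_mem _ _ hx
  induction x with
  | zero => simp
  | add x y hx hy => exact Submodule.add_mem _ hx hy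
  | tmul m v =>
    have : m ⊗ₜ[k] v = ((1 : R) ⊗ₜ[k] v) • (m ⊗ₜ[k] (1 : DegV k)) := by
      rw [act_tmul]; simp
    rw [this]
    exact Submodule.smul_mem _ _ (h1 m)

theorem finite_MV [Module.Finite R M] : Module.Finite (R ⊗[k] DegV k) (M ⊗[k] DegV k) := by
  classical
  obtain ⟨s, hs⟩ := Module.Finite.fg_top (R := R) (M := M)
  refine ⟨⟨s.image (fun m => m ⊗ₜ[k] (1 : DegV k)), ?_⟩⟩
  rw [Finset.coe_image]
  exact span_tmul_one k R M _ hs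

variable {M N}

theorem DegI.toLDeg [Module.Finite R M] (H : DegI k R M N) : LDeg R M N := by
  obtain ⟨Q, _, _, μ, g, hfin, hμs, hμr, hμk, hg, hgs⟩ := H
  have := finite_MV k R M
  obtain ⟨a, ha⟩ := fin_bound (tt k R) (tt_comm k R) g (LinearMap.range (hVK k R M)) (fun q => by
    obtain ⟨j, y, h⟩ := exists_hVK k R M (g q)
    exact ⟨j, y, h.symm⟩)
  obtain ⟨b, hb⟩ := fin_bound (tt k R) (tt_comm k R) (hVK k R M) (LinearMap.range g) (fun q => by
    obtain ⟨j, y, h⟩ := hgs (hVK k R M q)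
    exact ⟨j, y, h.symm⟩)
  -- the relation
  let Rel (x : ℕ → M) (q : Q) : Prop :=
    ∃ y, hVK k R M y = tt k R ^ a • g q ∧ ∀ i < a + b + 1, pc k M y i = x i
  have hRadd {x q x' q'} (h : Rel x q) (h' : Rel x' q') : Rel (x + x') (q + q') := by
    obtain ⟨y, h1, h2⟩ := h
    obtain ⟨y', h1', h2'⟩ := h'
    refine ⟨y + y', by rw [map_add, h1, h1', map_add, smul_add], fun i hi => ?_⟩
    rw [map_add, Pi.add_apply, Pi.add_apply, h2 i hi, h2' i hi]
  have hRr {x q} (r : R) (h : Rel x q) : Rel (r • x) ((r ⊗ₜ[k] (1 : DegV k)) • q) := by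
    obtain ⟨y, h1, h2⟩ := h
    refine ⟨(r ⊗ₜ[k] (1 : DegV k)) • y, ?_, fun i hi => ?_⟩
    · rw [map_smul, h1, map_smul, ← mul_smul, ← mul_smul, tt_pow_comm]
    · rw [pc_r, Pi.smul_apply, Pi.smul_apply, h2 i hi]
  have hRt {x q} (h : Rel x q) : Rel (shiftT M x) (tt k R • q) := by
    obtain ⟨y, h1, h2⟩ := h
    refine ⟨tt k R • y, ?_, fun i hi => ?_⟩
    · rw [map_smul, h1, map_smul, ← mul_smul, ← mul_smul, tt_pow_comm]
    · rw [pc_t]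
      cases i with
      | zero => rfl
      | succ i => exact h2 i (by omega)
  have hR0 {x q} (h : Rel x q) (hx : ∀ i < a + b + 1, x i = 0) : ∃ q', q = tt k R • q' := by
    obtain ⟨y, h1, h2⟩ := h
    obtain ⟨y', rfl⟩ := pc_div k R M (a + b + 1) y (fun i hi => (h2 i hi).trans (hx i hi))
    obtain ⟨q', hq'⟩ := hb y'
    refine ⟨q', hg (tt_pow_inj k R M a ?_)⟩
    rw [← h1, map_smul, map_smul, hq', ← mul_smul, ← mul_smul]
    congr 1
    rw [← pow_succ, ← pow_add]
    congr 1
    omega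
  have hRq (q) : ∃ x, Rel x q := by
    obtain ⟨y, hy⟩ := ha q
    exact ⟨pc k M y, y, hy, fun _ _ => rfl⟩
  have hRzero : Rel 0 0 := ⟨0, by simp, by simp⟩
  have hRneg {x q} (h : Rel x q) : Rel (-x) (-q) := by
    have := hRr (-1) h
    rw [TensorProduct.neg_tmul, neg_one_smul] at this
    change Rel _ (-(1 : R ⊗[k] DegV k) • q) at this
    rwa [neg_one_smul] at this
  have hRuniq {x q q'} (h : Rel x q) (h' : Rel x q') : μ q = μ q' := by
    rw [← sub_eq_zero, ← map_sub, hμk]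
    refine hR0 (x := x + -x) ?_ (by simp)
    rw [sub_eq_add_neg]
    exact hRadd h (hRneg h')
  let S : Submodule R (ℕ → M) :=
    { carrier := {x | ∃ q, Rel x q}
      add_mem' := fun ⟨q, h⟩ ⟨q', h'⟩ => ⟨_, hRadd h h'⟩
      zero_mem' := ⟨0, hRzero⟩
      smul_mem' := fun r x ⟨q, h⟩ => ⟨_, hRr r h⟩ }
  let φ : S →ₗ[R] N :=
    { toFun := fun x => μ x.2.choose
      map_add' := fun x y => by
        rw [← map_add]
        exact hRuniq (x + y).2.choose_spec (hRadd x.2.choose_spec y.2.choose_spec)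
      map_smul' := fun r x => by
        rw [RingHom.id_apply, ← hμr]
        exact hRuniq (r • x).2.choose_spec (hRr r x.2.choose_spec) }
  have hφ (x : S) (q) (h : Rel x.1 q) : φ x = μ q := hRuniq x.2.choose_spec h
  have hSn (x : ℕ → M) (hx : ∀ i < a + b, x i = 0) : x ∈ S := by
    obtain ⟨y, hy⟩ := pc_approx k M (a + b + 1) x
    obtain ⟨y', rfl⟩ := pc_div k R M (a + b) y (fun i hi => (hy i (by omega)).trans (hx i hi))
    obtain ⟨q, hq⟩ := hb y'
    refine ⟨q, _, ?_, hy⟩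
    rw [hq, map_smul, ← mul_smul, pow_add]
  refine ⟨S, a + b, φ, ?_, hSn, ?_, ?_⟩
  · rintro x ⟨q, h⟩
    exact ⟨_, hRt h⟩
  · intro z
    obtain ⟨q, rfl⟩ := hμs z
    obtain ⟨x, hx⟩ := hRq q
    exact ⟨⟨x, q, hx⟩, hφ _ _ hx⟩
  · rintro ⟨x, q, hxq⟩
    rw [hφ ⟨x, q, hxq⟩ q hxq, hμk]
    constructor
    · rintro ⟨q', rfl⟩
      obtain ⟨x', hx'⟩ := hRq q'
      have hd := hRt hx'
      obtain ⟨y, h1, h2⟩ := hxq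
      obtain ⟨y', h1', h2'⟩ := hd
      have hyy : y = y' := hVK_inj k R M (h1.trans h1'.symm)
      subst hyy
      have hagree : ∀ i < a + b + 1, x i = shiftT M x' i := fun i hi => 
        (h2 i hi).symm.trans (h2' i hi)
      refine ⟨fun i => x (i+1), ?_, ?_⟩
      · have : (fun i => x (i+1)) - x' ∈ S := hSn _ (fun i hi => by
          simp [hagree (i+1) (by omega), shiftT])
        have h2 := S.add_mem this (⟨q', hx'⟩ : x' ∈ S)
        simpa using h2
      · funext i
        cases i with
        | zero => exact hagree 0 (by omega)
        | succ i => rfl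
    · rintro ⟨x', ⟨q', h'⟩, rfl⟩
      rw [← hμk, hRuniq hxq (hRt h'), hμk]
      exact ⟨_, rfl⟩

theorem LDeg.toDegI [Module.Finite R M] [Module.Finite R N] (H : LDeg R M N) : DegI k R M N := by
  classical
  obtain ⟨S, n, φ, hT, hn, hs, hk⟩ := H
  let Q : Submodule (R ⊗[k] DegV k) (M ⊗[k] DegV k) :=
    { carrier := {y | pc k M y ∈ S}
      add_mem' := fun {x y} hx hy => by
        change pc k M (x + y) ∈ S
        rw [map_add]; exact S.add_mem hx hy
      zero_mem' := by
        change pc k M 0 ∈ S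
        rw [map_zero]; exact S.zero_mem
      smul_mem' := fun a y hy => pc_stable k R M S hT n hn a y hy }
  have hQ (y) : y ∈ Q ↔ pc k M y ∈ S := Iff.rfl
  let μ : Q →+ N :=
    { toFun := fun y => φ ⟨pc k M y.1, y.2⟩
      map_zero' := by
        refine (congrArg φ (Subtype.ext ?_)).trans (map_zero φ)
        exact map_zero _
      map_add' := fun x y => by
        rw [← map_add]; congr 1; ext1
        exact map_add _ _ _ }
  have hμ (y : Q) : μ y = φ ⟨pc k M y.1, y.2⟩ := rfl
  have hμr : ∀ (r : R) (q : Q), μ ((r ⊗ₜ[k] (1 : DegV k)) • q) = r • μ q := by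
    intro r q
    rw [hμ, hμ, ← map_smul]
    congr 1; ext1
    exact pc_r k R M r q.1
  have hμs : Function.Surjective μ := by
    intro z
    obtain ⟨x, rfl⟩ := hs z
    obtain ⟨y, hy⟩ := pc_approx k M (n + 1) x.1
    have h1 : pc k M y - x.1 ∈ S := hn _ (fun i hi => by simp [hy i (by omega)])
    have h2 : y ∈ Q := by
      rw [hQ]; simpa using S.add_mem h1 x.2
    refine ⟨⟨y, h2⟩, ?_⟩
    rw [hμ, ← sub_eq_zero, ← map_sub, hk]
    refine ⟨fun i => pc k M y (i+1) - x.1 (i+1), hn _ (fun i hi => ?_), ?_⟩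
    · simp [hy (i+1) (by omega)]
    · funext i
      cases i with
      | zero => simp [hy 0, shiftT]
      | succ i => simp [shiftT]
  have hμk : ∀ q : Q, μ q = 0 ↔ ∃ q', q = tt k R • q' := by
    rintro ⟨y, hy⟩
    rw [hμ, hk]
    constructor
    · rintro ⟨x, hx, hxy⟩
      change pc k M y = _ at hxy
      obtain ⟨y', rfl⟩ := pc_div k R M 1 y (fun i hi => by
        rw [hxy, Nat.lt_one_iff.1 hi]; rfl)
      rw [pow_one, pc_t] at hxy
      have h3 : pc k M y' = x := by
        funext i
        exact congrFun hxy (i+1)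
      refine ⟨⟨y', by rw [hQ, h3]; exact hx⟩, ?_⟩
      ext1
      simp
    · rintro ⟨q', h⟩
      refine ⟨_, q'.2, ?_⟩
      rw [← pc_t k R, h]
      rfl
  have hnQ (y : M ⊗[k] DegV k) : tt k R ^ n • y ∈ Q := by
    rw [hQ]
    apply hn
    have hz : ∀ j (z : M ⊗[k] DegV k), ∀ i < j, pc k M (tt k R ^ j • z) i = 0 := by
      intro j
      induction j with
      | zero => simp
      | succ j ih =>
        intro z i hi
        rw [pow_succ', mul_smul, pc_t]
        cases i with
        | zero => rfl
        | succ i => exact ih z i (by omega)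
    exact hz n y
  refine ⟨Q, inferInstance, inferInstance, μ, (hVK k R M) ∘ₗ Q.subtype, ?_, hμs, hμr, hμk, ?_, ?_⟩
  · obtain ⟨s, hs⟩ := Module.Finite.fg_top (R := R) (M := M)
    obtain ⟨s', hs'⟩ := Module.Finite.fg_top (R := R) (M := N)
    choose l hl using hμs
    let s1 : Finset Q := s'.image l
    let s2 : Finset Q := s.image (fun m => ⟨tt k R ^ n • (m ⊗ₜ[k] (1 : DegV k)), hnQ _⟩)
    refine ⟨⟨s1 ∪ s2, ?_⟩⟩
    set P := Submodule.span (R ⊗[k] DegV k) ((s1 ∪ s2 : Finset Q) : Set Q) with hP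
    have hP2 : ∀ y : M ⊗[k] DegV k, (⟨_, hnQ y⟩ : Q) ∈ P := by
      intro y
      have hy : y ∈ Submodule.span (R ⊗[k] DegV k)
          ((fun m => m ⊗ₜ[k] (1 : DegV k)) '' (s : Set M)) := by
        rw [span_tmul_one k R M _ hs]; trivial
      induction hy using Submodule.span_induction with
      | mem x hx =>
        obtain ⟨m, hm, rfl⟩ := hx
        apply Submodule.subset_span
        rw [Finset.coe_union]
        right
        exact Finset.mem_coe.2 (Finset.mem_image.2 ⟨m, hm, rfl⟩)
      | zero => convert P.zero_mem using 1; ext1; simp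
      | add x y _ _ hx hy => convert P.add_mem hx hy using 1; ext1; simp
      | smul c x _ hx => 
        convert P.smul_mem c hx using 1; ext1
        change _ = c • _
        simp only [← mul_smul, tt_pow_comm]
    have hP1 : ∀ z : N, ∃ p ∈ P, μ p = z := by
      intro z
      have hz : z ∈ Submodule.span R (s' : Set N) := hs' ▸ Submodule.mem_top
      induction hz using Submodule.span_induction with
      | mem x hx =>
        refine ⟨l x, Submodule.subset_span ?_, hl x⟩
        rw [Finset.coe_union]
        left
        exact Finset.mem_coe.2 (Finset.mem_image.2 ⟨x, hx, rfl⟩)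
      | zero => exact ⟨0, P.zero_mem, map_zero _⟩
      | add x y _ _ hx hy =>
        obtain ⟨p, hp, rfl⟩ := hx
        obtain ⟨p', hp', rfl⟩ := hy
        exact ⟨_, P.add_mem hp hp', map_add _ _ _⟩
      | smul c x _ hx =>
        obtain ⟨p, hp, rfl⟩ := hx
        exact ⟨_, P.smul_mem _ hp, hμr c p⟩
    have hPn : ∀ j (q : Q), ∃ p ∈ P, ∃ q', q = p + tt k R ^ j • q' := by
      intro j
      induction j with
      | zero => exact fun q => ⟨0, P.zero_mem, q, by simp⟩
      | succ j ih =>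
        intro q
        obtain ⟨p, hp, q', rfl⟩ := ih q
        obtain ⟨p', hp', h⟩ := hP1 (μ q')
        obtain ⟨q'', h⟩ := (hμk (q' - p')).1 (by rw [map_sub, h, sub_self])
        refine ⟨p + tt k R ^ j • p', P.add_mem hp (P.smul_mem _ hp'), q'', ?_⟩
        rw [pow_succ, mul_smul, ← h, smul_sub]
        abel
    rw [eq_top_iff]
    rintro q -
    obtain ⟨p, hp, q', rfl⟩ := hPn n q
    exact P.add_mem hp (hP2 q'.1)
  · exact (hVK_inj k R M).comp Subtype.val_injective
  · intro x
    obtain ⟨j, y, h⟩ := exists_hVK k R M x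
    refine ⟨n + j, ⟨_, hnQ y⟩, ?_⟩
    rw [pow_add, mul_smul, h]
    simp

end Interface

section Final

attribute [local instance] actModule

variable (k : Type) [Field k] (R : Type) [Ring R] [Algebra k R]
  (M : Type) [AddCommGroup M] [Module R M] (N : Type) [AddCommGroup N] [Module R N]

theorem compHom_tower :
    letI : Module k M := Module.compHom M (algebraMap k R)
    IsScalarTower k R M := by
  letI : Module k M := Module.compHom M (algebraMap k R)
  refine ⟨fun c r m => ?_⟩
  rw [Algebra.smul_def, mul_smul]
  rfl

variable {M N}

theorem algebraMap_smul_loc (Q : Type) [AddCommGroup Q] [Module (DegV k) Q] (v : DegV k)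
    (x : LocalizedModule (Submonoid.powers (degT k)) Q) :
    (algebraMap (DegV k) (DegK k) v) • x = v • x :=
  algebraMap_smul (Localization (Submonoid.powers (degT k))) v x

theorem Degenerates.toDegI (H : Degenerates k R M N) :
    letI : Module k M := Module.compHom M (algebraMap k R)
    letI := compHom_tower k R M
    DegI k R M N := by
  letI : Module k M := Module.compHom M (algebraMap k R)
  letI := compHom_tower k R M
  obtain ⟨Q, iQ, iQ', hfin, hflat, ⟨e⟩, f, hfK, hfR⟩ := H
  letI := vRestrict k R Q
  letI := rRestrict k R (Q ⧸ LinearMap.range (tSmul k R Q))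
  let g0 : Q → M ⊗[k] DegK k := fun q => f (LocalizedModule.mk q 1)
  have hgv (v : DegV k) (q : Q) : g0 (((1 : R) ⊗ₜ[k] v) • q) = ((1 : R) ⊗ₜ[k] v) • g0 q := by
    rw [act_eq_lTensor, ← hfK, algebraMap_smul_loc, LocalizedModule.smul'_mk]
    rfl
  have hgr (r : R) (q : Q) : g0 ((r ⊗ₜ[k] (1 : DegV k)) • q) = (r ⊗ₜ[k] (1 : DegV k)) • g0 q := by
    rw [act_eq_rTensor]
    refine Eq.trans ?_ (hfR r (LocalizedModule.mk q 1))
    erw [IsLocalizedModule.map_LocalizedModules]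
    rfl
  have hgadd (q q' : Q) : g0 (q + q') = g0 q + g0 q' := by
    simp only [g0]
    rw [← map_add, LocalizedModule.mk_add_mk]
    simp
  let g : Q →ₗ[R ⊗[k] DegV k] M ⊗[k] DegK k :=
    { toFun := g0
      map_add' := hgadd
      map_smul' := fun a q => by
        rw [RingHom.id_apply]
        induction a with
        | zero =>
          have := hgadd 0 0
          simp only [zero_smul]
          simpa using this
        | add a b ha hb => rw [add_smul, hgadd, ha, hb, add_smul]
        | tmul r v =>
          have : r ⊗ₜ[k] v = (r ⊗ₜ (1 : DegV k)) * ((1 : R) ⊗ₜ v) := by simp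
          rw [this, mul_smul, mul_smul, hgr, hgv] }
  let μ : Q →+ N := (e.toLinearMap.toAddMonoidHom).comp
    (Submodule.mkQ (LinearMap.range (tSmul k R Q))).toAddMonoidHom
  have hμ (q) : μ q = e (Submodule.Quotient.mk q) := rfl
  refine ⟨Q, iQ, iQ', μ, g, hfin, ?_, ?_, ?_, ?_, ?_⟩
  · intro z
    obtain ⟨q, hq⟩ := Submodule.Quotient.mk_surjective _ (e.symm z)
    exact ⟨q, by rw [hμ, hq, e.apply_symm_apply]⟩
  · intro r q
    rw [hμ, hμ, ← map_smul]
    rfl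
  · intro q
    rw [hμ, e.map_eq_zero_iff, Submodule.Quotient.mk_eq_zero]
    constructor
    · rintro ⟨q', rfl⟩; exact ⟨q', rfl⟩
    · rintro ⟨q', rfl⟩; exact ⟨q', rfl⟩
  · intro q q' h
    have h1 : LocalizedModule.mk q 1 = (LocalizedModule.mk q' 1 :
        LocalizedModule (Submonoid.powers (degT k)) Q) := f.injective h
    rw [LocalizedModule.mk_eq] at h1
    obtain ⟨u, hu⟩ := h1
    rw [one_smul, one_smul] at hu
    exact Module.Flat.isSMulRegular_of_nonZeroDivisors (powers_le k u.2) hu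
  · intro x
    obtain ⟨x, rfl⟩ := f.surjective x
    induction x using LocalizedModule.induction_on with
    | h q s =>
      obtain ⟨s, n, rfl⟩ := s
      refine ⟨n, q, ?_⟩
      rw [tt_pow, act_eq_lTensor, ← hfK, algebraMap_smul_loc, LocalizedModule.smul'_mk]
      change _ = f _
      congr 1
      exact LocalizedModule.mk_cancel (⟨degT k ^ n, n, rfl⟩ : Submonoid.powers (degT k)) q

theorem DegI.toDegenerates 
    (H : letI : Module k M := Module.compHom M (algebraMap k R)
      letI := compHom_tower k R M
      DegI k R M N) : Degenerates k R M N := by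
  letI : Module k M := Module.compHom M (algebraMap k R)
  letI := compHom_tower k R M
  obtain ⟨Q, iQ, iQ', μ, g, hfin, hμs, hμr, hμk, hg, hgs⟩ := H
  letI := vRestrict k R Q
  letI := vRestrict k R (M ⊗[k] DegK k)
  have hVQ (v : DegV k) (q : Q) : v • q = ((1 : R) ⊗ₜ[k] v) • q := rfl
  have hVM (v : DegV k) (q : M ⊗[k] DegK k) : v • q = ((1 : R) ⊗ₜ[k] v) • q := rfl
  refine ⟨Q, iQ, iQ', hfin, ?_, ?_, ?_⟩
  · have : Module.IsTorsionFree (DegV k) Q := by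
      refine ⟨fun v hv q q' h => ?_⟩
      have h1 : ((1 : R) ⊗ₜ[k] v) • (q - q') = 0 := by
        rw [smul_sub, sub_eq_zero]; exact h
      rw [← sub_eq_zero]
      apply hg
      rw [map_zero]
      apply smul_inj k R M v hv.ne_zero
      rw [← map_smul, h1, map_zero]
    change Module.Flat (DegV k) Q
    infer_instance
  · letI := rRestrict k R (Q ⧸ LinearMap.range (tSmul k R Q))
    let ν : (Q ⧸ LinearMap.range (tSmul k R Q)) →+ N := 
      QuotientAddGroup.lift (LinearMap.range (tSmul k R Q)).toAddSubgroup μ (by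
        rintro q ⟨q', rfl⟩
        exact (hμk _).2 ⟨q', rfl⟩)
    have hν (q : Q) : ν (Submodule.Quotient.mk q) = μ q := rfl
    let νL : (Q ⧸ LinearMap.range (tSmul k R Q)) →ₗ[R] N :=
      { toFun := ν
        map_add' := map_add ν
        map_smul' := fun r x => by
          obtain ⟨q, rfl⟩ := Submodule.Quotient.mk_surjective _ x
          rw [hν]
          exact hμr r q }
    refine ⟨LinearEquiv.ofBijective νL ⟨?_, ?_⟩⟩
    · rw [injective_iff_map_eq_zero]
      intro x hx
      obtain ⟨q, rfl⟩ := Submodule.Quotient.mk_surjective _ x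
      obtain ⟨q', rfl⟩ := (hμk q).1 hx
      rw [Submodule.Quotient.mk_eq_zero]
      exact ⟨q', rfl⟩
    · intro z
      obtain ⟨q, rfl⟩ := hμs z
      exact ⟨Submodule.Quotient.mk q, rfl⟩
  · let gV : Q →ₗ[DegV k] M ⊗[k] DegK k :=
      { toFun := g
        map_add' := map_add g
        map_smul' := fun v q => map_smul g _ q }
    have hinj : ∀ (s : Submonoid.powers (degT k)) (x y : M ⊗[k] DegK k),
        (s : DegV k) • x = (s : DegV k) • y → x = y := by
      rintro ⟨_, n, rfl⟩ x y h
      apply tt_pow_inj k R M n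
      rw [tt_pow]
      exact h
    have hloc : IsLocalizedModule (Submonoid.powers (degT k)) gV := by
      refine ⟨fun s => ?_, fun x => ?_, fun {q q'} h => ?_⟩
      · rw [Module.End.isUnit_iff]
        refine ⟨fun x y h => hinj s x y h, fun x => ?_⟩
        obtain ⟨_, n, rfl⟩ := s
        obtain ⟨y, hy⟩ := tt_pow_surj k R M n x
        refine ⟨y, ?_⟩
        rw [tt_pow] at hy
        exact hy
      · obtain ⟨j, q, h⟩ := hgs x
        refine ⟨⟨q, ⟨degT k ^ j, j, rfl⟩⟩, ?_⟩
        rw [tt_pow] at h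
        exact h
      · refine ⟨1, ?_⟩
        rw [hg h]
    let f := IsLocalizedModule.iso (Submonoid.powers (degT k)) gV
    have hf (q : Q) (s : Submonoid.powers (degT k)) : (s : DegV k) • f (LocalizedModule.mk q s) = g q := by
      rw [← map_smul, LocalizedModule.smul'_mk]
      have := LocalizedModule.mk_cancel s q
      rw [Submonoid.smul_def] at this
      rw [this]
      exact IsLocalizedModule.iso_mk_one _ gV q
    have hact (v : DegV k) (z : M ⊗[k] DegK k) : 
        LinearMap.lTensor M (LinearMap.mulLeft k (algebraMap (DegV k) (DegK k) v)) z = v • z :=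
      (act_eq_lTensor k R M (DegK k) v z).symm
    refine ⟨f.toAddEquiv, ?_, ?_⟩
    · intro c x
      change f (c • x) = LinearMap.lTensor M (LinearMap.mulLeft k c) (f x)
      obtain ⟨v, s, rfl⟩ := IsLocalization.exists_mk'_eq (Submonoid.powers (degT k)) c
      apply hinj s
      rw [← map_smul, ← algebraMap_smul_loc, ← mul_smul, IsLocalization.mk'_spec',
        algebraMap_smul_loc, map_smul, ← hact, ← hact, ← LinearMap.comp_apply, ← LinearMap.lTensor_comp,
        ← LinearMap.mulLeft_mul, IsLocalization.mk'_spec']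
    · intro r x
      change f _ = LinearMap.rTensor (DegK k) (rActK k R M r) (f x)
      induction x using LocalizedModule.induction_on with
      | h q s =>
        apply hinj s
        erw [IsLocalizedModule.map_LocalizedModules]
        rw [hf]
        have h2 : LinearMap.rTensor (DegK k) (rActK k R M r) (f (LocalizedModule.mk q s))
            = (r ⊗ₜ[k] (1 : DegV k)) • f (LocalizedModule.mk q s) :=
          (act_eq_rTensor k R M (DegK k) r _).symm
        rw [h2, hVM, ← mul_smul]
        have h3 : ((1 : R) ⊗ₜ[k] (s : DegV k)) * (r ⊗ₜ[k] (1 : DegV k))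
          = (r ⊗ₜ[k] (1 : DegV k)) * ((1 : R) ⊗ₜ[k] (s : DegV k)) := by simp
        rw [h3, mul_smul, ← hVM, hf]
        exact map_smul g _ q

theorem degenerates_iff [Module.Finite R M] [Module.Finite R N] :
    Degenerates k R M N ↔ LDeg R M N := by
  letI : Module k M := Module.compHom M (algebraMap k R)
  letI := compHom_tower k R M
  exact ⟨fun h => DegI.toLDeg k R (Degenerates.toDegI k R h),
    fun h => DegI.toDegenerates k R (LDeg.toDegI k R h)⟩

theorem mem_CC (X : Set (FGMod R)) (N : FGMod R) : N ∈ CC k R X ↔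
    ∃ M ∈ X, ∃ n : ℕ, 0 < n ∧ LDeg R (Fin n → M.carrier) (Fin n → N.carrier) := by
  constructor
  · rintro ⟨M, hM, n, hn, h⟩
    exact ⟨M, hM, n, hn, (degenerates_iff k R).1 h⟩
  · rintro ⟨M, hM, n, hn, h⟩
    exact ⟨M, hM, n, hn, (degenerates_iff k R).2 h⟩

theorem subset_CC (X : Set (FGMod R)) : X ⊆ CC k R X := fun M hM =>
  (mem_CC k R X M).2 ⟨M, hM, 1, one_pos, LDeg.refl _⟩

theorem CC_mono {X Y : Set (FGMod R)} (h : X ⊆ Y) : CC k R X ⊆ CC k R Y := by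
  rintro N ⟨M, hM, H⟩
  exact ⟨M, h hM, H⟩

/-- `M^{mn} = (M^n)^m`. -/
def powEquiv (M : Type) [AddCommGroup M] [Module R M] (m n : ℕ) :
    (Fin (m * n) → M) ≃ₗ[R] (Fin m → Fin n → M) :=
  (LinearEquiv.funCongrLeft R M finProdFinEquiv).trans (LinearEquiv.curry R M (Fin m) (Fin n))

def powEquiv' (M : Type) [AddCommGroup M] [Module R M] (m n : ℕ) :
    (Fin (m * n) → M) ≃ₗ[R] (Fin n → Fin m → M) :=
  (LinearEquiv.funCongrLeft R M ((Equiv.prodComm _ _).trans finProdFinEquiv)).trans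
    (LinearEquiv.curry R M (Fin n) (Fin m))

theorem CC_idem (X : Set (FGMod R)) : CC k R (CC k R X) = CC k R X := by
  apply Set.Subset.antisymm _ (subset_CC k R _)
  intro L hL
  rw [mem_CC] at hL
  obtain ⟨N, hN, m, hm, h₂⟩ := hL
  rw [mem_CC] at hN
  obtain ⟨M, hM, n, hn, h₁⟩ := hN
  rw [mem_CC]
  exact ⟨M, hM, m * n, Nat.mul_pos hm hn,
    LDeg.trans (LDeg.pow (powEquiv R _ m n) (powEquiv R _ m n) h₁)
      (LDeg.pow (powEquiv' R _ m n) (powEquiv' R _ m n) h₂)⟩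

end Final

/-- `𝒞(M)` is a nonempty irreducible closed set. -/
theorem CC_singleton_irreducible (k : Type) [Field k] (R : Type) [Ring R] [Algebra k R]
    (M : FGMod R) :
    CC k R (CC k R {M}) = CC k R {M} ∧
    M ∈ CC k R {M} ∧
    (∀ X Y : Set (FGMod R), CC k R X = X → CC k R Y = Y →
      CC k R {M} = X ∪ Y → CC k R {M} = X ∨ CC k R {M} = Y) := by
  refine ⟨CC_idem k R _, subset_CC k R _ rfl, ?_⟩
  have key : ∀ X : Set (FGMod R), CC k R X = X → M ∈ X → CC k R {M} ⊆ X := by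
    intro X hX hM
    rw [← hX]
    exact CC_mono k R (Set.singleton_subset_iff.2 hM)
  intro X Y hX hY h
  have hM : M ∈ X ∪ Y := h ▸ subset_CC k R _ rfl
  rcases hM with hM | hM
  · exact Or.inl ((key X hX hM).antisymm (h ▸ Set.subset_union_left))
  · exact Or.inr ((key Y hY hM).antisymm (h ▸ Set.subset_union_right))
end
end
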